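/- arXiv:1408.5812 — 2 statements merged into one kernel-verified Lean document; each statement's English description precedes it below -/
import Mathlib

section
/- For Lebesgue-almost every r ∈ [0,1] with continued fraction expansion [a₁, a₂, …], one has lim_{n→∞} (∑_{i=1}^n a_i − max_{i≤n} a_i)/(n log n) = 1/log 2. -/
open MeasureTheory Real Filter

/-- The Gauss map. -/
noncomputable def gaussMap (x : ℝ) : ℝ := Int.fract x⁻¹

/-- `cfCoeff r n` is the `(n+1)`-st continued fraction coefficient `a_{n+1}` of `r`. -/
noncomputable def cfCoeff (r : ℝ) (n : ℕ) : ℕ := (⌊(gaussMap^[n] r)⁻¹⌋).toNat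

namespace DV

/-- Transition weights of the Gauss map transfer operator. -/
noncomputable def pk (k : ℕ) (x : ℝ) : ℝ := (1 + x) / ((k + 1 + x) * (k + 2 + x))

lemma pk_nonneg (k : ℕ) {x : ℝ} (hx : 0 ≤ x) : 0 ≤ pk k x := by
  unfold pk; positivity

lemma pk_partial (m : ℕ) (hm : 1 ≤ m) {x : ℝ} (hx : 0 ≤ x) (N : ℕ) :
    ∑ k ∈ Finset.range N, (if m ≤ k + 1 then pk k x else 0) =
      if m ≤ N + 1 then (1 + x) / (m + x) - (1 + x) / (N + 1 + x) else 0 := by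
  induction N with
  | zero =>
    simp only [Finset.range_zero, Finset.sum_empty]
    split_ifs with h
    · have : m = 1 := by omega
      subst this; simp
    · rfl
  | succ N ih =>
    rw [Finset.sum_range_succ, ih]
    have hm' : (0:ℝ) < m := by exact_mod_cast hm
    by_cases h : m ≤ N + 1
    · rw [if_pos h, if_pos h, if_pos (by omega)]
      unfold pk
      push_cast
      have h1 : (N:ℝ) + 1 + x ≠ 0 := by positivity
      have h2 : (N:ℝ) + 1 + 1 + x ≠ 0 := by positivity
      have h3 : (N:ℝ) + 2 + x ≠ 0 := by positivity
      have h4 : (m:ℝ) + x ≠ 0 := by positivity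
      field_simp
      ring
    · rw [if_neg h, if_neg h]
      split_ifs with h'
      · have : m = N + 1 + 1 := by omega
        subst this; push_cast; ring
      · simp

lemma pk_hasSum_ge (m : ℕ) (hm : 1 ≤ m) {x : ℝ} (hx : 0 ≤ x) :
    HasSum (fun k : ℕ => if m ≤ k + 1 then pk k x else 0) ((1 + x) / (m + x)) := by
  rw [hasSum_iff_tendsto_nat_of_nonneg]
  · have h0 : Tendsto (fun N : ℕ => (1 + x) / (m + x) - (1 + x) / ((N:ℝ) + 1 + x)) atTop
        (nhds ((1 + x) / (m + x) - 0)) := by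
      refine Tendsto.sub tendsto_const_nhds ?_
      refine Tendsto.div_atTop tendsto_const_nhds ?_
      refine tendsto_atTop_add_const_right _ _ ?_
      refine tendsto_atTop_add_const_right _ _ ?_
      exact tendsto_natCast_atTop_atTop
    rw [sub_zero] at h0
    refine h0.congr' ?_
    filter_upwards [eventually_ge_atTop m] with N hN
    rw [pk_partial m hm hx, if_pos (by omega)]
  · intro k
    split_ifs
    · exact pk_nonneg k hx
    · exact le_rfl

lemma pk_hasSum {x : ℝ} (hx : 0 ≤ x) : HasSum (fun k : ℕ => pk k x) 1 := by
  have h := pk_hasSum_ge 1 le_rfl hx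
  have h2 : (1 + x) / ((1:ℕ) + x) = 1 := by
    push_cast; exact div_self (by positivity)
  rw [h2] at h
  simpa using h

/-- coefficients of the contraction bound -/
noncomputable def ck (k : ℕ) : ℝ :=
  if k = 0 then 3 / 4 else (k + 4) / ((k + 1) ^ 2 * (k + 2) ^ 2)

lemma ck_sum (N : ℕ) : ∑ k ∈ Finset.range N, ck k ≤ 49 / 50 := by
  have key : ∀ N : ℕ, ∑ k ∈ Finset.range (N + 1), ck k ≤
      49 / 50 - (1 / (2 * ((N:ℝ) + 2) ^ 2) + 5 / (6 * ((N:ℝ) + 2) ^ 3)) := by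
    intro N
    induction N with
    | zero => simp [ck]; norm_num
    | succ N ih =>
      rw [Finset.sum_range_succ]
      refine (add_le_add_left ih _).trans ?_
      unfold ck
      rw [if_neg (by omega)]
      push_cast
      have : (0:ℝ) ≤ N := Nat.cast_nonneg N
      have e : 1 / (2 * ((N:ℝ) + 2) ^ 2) + 5 / (6 * ((N:ℝ) + 2) ^ 3)
          - (1 / (2 * ((N:ℝ) + 1 + 2) ^ 2) + 5 / (6 * ((N:ℝ) + 1 + 2) ^ 3))
          - ((N:ℝ) + 1 + 4) / (((N:ℝ) + 1 + 1) ^ 2 * ((N:ℝ) + 1 + 2) ^ 2)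
          = 5 / (6 * ((N:ℝ) + 2) ^ 3 * ((N:ℝ) + 3) ^ 3) := by
        field_simp
        ring
      have : 0 ≤ 5 / (6 * ((N:ℝ) + 2) ^ 3 * ((N:ℝ) + 3) ^ 3) := by positivity
      linarith
  cases N with
  | zero => simp; norm_num
  | succ N =>
    refine (key N).trans ?_
    have : 0 ≤ (1 / (2 * ((N:ℝ) + 2) ^ 2) + 5 / (6 * ((N:ℝ) + 2) ^ 3)) := by positivity
    linarith

lemma inv_mem (k : ℕ) {x : ℝ} (hx : x ∈ Set.Icc (0:ℝ) 1) :
    1 / ((k:ℝ) + 1 + x) ∈ Set.Icc (0:ℝ) 1 := by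
  have : (0:ℝ) ≤ k := Nat.cast_nonneg k
  have := hx.1
  refine ⟨by positivity, ?_⟩
  rw [div_le_one (by positivity)]; linarith

lemma pk_bound0 {x y : ℝ} (hx : x ∈ Set.Icc (0:ℝ) 1) (hy : y ∈ Set.Icc (0:ℝ) 1) :
    pk 0 x * (1 / (((0:ℕ):ℝ) + 1 + x) * (1 / (((0:ℕ):ℝ) + 1 + y))) ≤ 1 / 2 ∧
    |pk 0 x - pk 0 y| * (1 / (((0:ℕ):ℝ) + 1 + y)) ≤ 1 / 4 * |x - y| := by
  obtain ⟨hx0, hx1⟩ := hx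
  obtain ⟨hy0, hy1⟩ := hy
  have e : ∀ z : ℝ, 0 ≤ z → pk 0 z = 1 / (2 + z) := by
    intro z hz; unfold pk; push_cast; field_simp; ring
  rw [e x hx0, e y hy0]
  push_cast
  constructor
  · have h1 : 1 / (2 + x) ≤ 1 / 2 := one_div_le_one_div_of_le (by norm_num) (by linarith)
    have h2 : 1 / (0 + 1 + x) ≤ 1 := by rw [div_le_one (by linarith)]; linarith
    have h3 : 1 / (0 + 1 + y) ≤ 1 := by rw [div_le_one (by linarith)]; linarith
    have h4 : 1 / (0 + 1 + x) * (1 / (0 + 1 + y)) ≤ 1 :=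
      mul_le_one₀ h2 (by positivity) h3
    calc _ ≤ 1 / 2 * 1 := mul_le_mul h1 h4 (by positivity) (by norm_num)
      _ = _ := by norm_num
  · have h : 1 / (2 + x) - 1 / (2 + y) = (y - x) * (1 / ((2 + x) * (2 + y))) := by
      field_simp
      ring
    rw [h, abs_mul, abs_of_nonneg (by positivity : 0 ≤ 1 / ((2 + x) * (2 + y))), abs_sub_comm y x]
    have h1 : 1 / ((2 + x) * (2 + y)) ≤ 1 / 4 :=
      one_div_le_one_div_of_le (by norm_num) (by nlinarith)
    have h3 : 1 / (0 + 1 + y) ≤ 1 := by rw [div_le_one (by linarith)]; linarith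
    have h4 : 1 / ((2 + x) * (2 + y)) * (1 / (0 + 1 + y)) ≤ 1 / 4 * 1 :=
      mul_le_mul h1 h3 (by positivity) (by norm_num)
    nlinarith [abs_nonneg (x - y)]

lemma pk_bound (k : ℕ) (hk : 1 ≤ k) {x y : ℝ} (hx : x ∈ Set.Icc (0:ℝ) 1)
    (hy : y ∈ Set.Icc (0:ℝ) 1) :
    pk k x * (1 / ((k:ℝ) + 1 + x) * (1 / ((k:ℝ) + 1 + y))) ≤
      2 / (((k:ℝ) + 1) ^ 2 * ((k:ℝ) + 2) ^ 2) ∧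
    |pk k x - pk k y| * (1 / ((k:ℝ) + 1 + y)) ≤
      1 / (((k:ℝ) + 1) ^ 2 * ((k:ℝ) + 2)) * |x - y| := by
  obtain ⟨hx0, hx1⟩ := hx
  obtain ⟨hy0, hy1⟩ := hy
  have hk' : (1:ℝ) ≤ k := by exact_mod_cast hk
  constructor
  · have h1 : (1 + x) / ((k:ℝ) + 1 + x) ≤ 2 / ((k:ℝ) + 2) := by
      rw [div_le_div_iff₀ (by positivity) (by positivity)]; nlinarith
    have h2 : 1 / ((k:ℝ) + 2 + x) ≤ 1 / ((k:ℝ) + 2) :=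
      one_div_le_one_div_of_le (by positivity) (by linarith)
    have h3 : 1 / ((k:ℝ) + 1 + x) ≤ 1 / ((k:ℝ) + 1) :=
      one_div_le_one_div_of_le (by positivity) (by linarith)
    have h4 : 1 / ((k:ℝ) + 1 + y) ≤ 1 / ((k:ℝ) + 1) :=
      one_div_le_one_div_of_le (by positivity) (by linarith)
    have h5 : pk k x = (1 + x) / ((k:ℝ) + 1 + x) * (1 / ((k:ℝ) + 2 + x)) := by
      unfold pk; field_simp
    rw [h5]
    calc _ ≤ 2 / ((k:ℝ) + 2) * (1 / ((k:ℝ) + 2)) * (1 / ((k:ℝ) + 1) * (1 / ((k:ℝ) + 1))) := by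
          gcongr
      _ = _ := by field_simp
  · have h : pk k x - pk k y = (x - y) * (((k:ℝ) ^ 2 + k - 1 - x - y - x * y) /
        (((k:ℝ) + 1 + x) * (k + 2 + x) * ((k + 1 + y) * (k + 2 + y)))) := by
      unfold pk
      field_simp
      ring
    have h1 : |((k:ℝ) ^ 2 + k - 1 - x - y - x * y) /
        (((k:ℝ) + 1 + x) * (k + 2 + x) * ((k + 1 + y) * (k + 2 + y)))| ≤
        1 / (((k:ℝ) + 1) * ((k:ℝ) + 2)) := by
      rw [abs_div, abs_of_nonneg (by positivity :
        0 ≤ (((k:ℝ) + 1 + x) * (k + 2 + x) * ((k + 1 + y) * (k + 2 + y))))]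
      have a1 : |(k:ℝ) ^ 2 + k - 1 - x - y - x * y| ≤ ((k:ℝ) + 1) * ((k:ℝ) + 2) := by
        rw [abs_le]; constructor <;> nlinarith [mul_nonneg hx0 hy0, mul_le_one₀ hx1 hy0 hy1]
      have a2 : (((k:ℝ) + 1) * ((k:ℝ) + 2)) * (((k:ℝ) + 1) * ((k:ℝ) + 2)) ≤
          (((k:ℝ) + 1 + x) * (k + 2 + x) * ((k + 1 + y) * (k + 2 + y))) := by
        have u1 : ∀ z : ℝ, 0 ≤ z → ((k:ℝ) + 1) * ((k:ℝ) + 2) ≤ ((k:ℝ) + 1 + z) * (k + 2 + z) :=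
          fun z hz => mul_le_mul (by linarith) (by linarith) (by positivity) (by positivity)
        exact mul_le_mul (u1 x hx0) (u1 y hy0) (by positivity) (by positivity)
      rw [div_le_div_iff₀ (by positivity) (by positivity), one_mul]
      refine le_trans ?_ a2
      gcongr
    rw [h, abs_mul]
    have h4 : 1 / ((k:ℝ) + 1 + y) ≤ 1 / ((k:ℝ) + 1) :=
      one_div_le_one_div_of_le (by positivity) (by linarith)
    calc _ ≤ |x - y| * (1 / (((k:ℝ) + 1) * ((k:ℝ) + 2))) * (1 / ((k:ℝ) + 1)) := by gcongr
      _ = _ := by field_simp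

lemma term_bound (f : ℝ → ℝ) (L : ℝ) (hL : 0 ≤ L)
    (hf : ∀ x ∈ Set.Icc (0:ℝ) 1, ∀ y ∈ Set.Icc (0:ℝ) 1, |f x - f y| ≤ L * |x - y|)
    (k : ℕ) {x y : ℝ} (hx : x ∈ Set.Icc (0:ℝ) 1) (hy : y ∈ Set.Icc (0:ℝ) 1) :
    |pk k x * (f (1 / ((k:ℝ) + 1 + x)) - f 0) - pk k y * (f (1 / ((k:ℝ) + 1 + y)) - f 0)| ≤
      ck k * (L * |x - y|) := by
  have hx0 := hx.1
  have hy0 := hy.1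
  have e : pk k x * (f (1 / ((k:ℝ) + 1 + x)) - f 0) - pk k y * (f (1 / ((k:ℝ) + 1 + y)) - f 0)
      = pk k x * (f (1 / ((k:ℝ) + 1 + x)) - f (1 / ((k:ℝ) + 1 + y)))
        + (pk k x - pk k y) * (f (1 / ((k:ℝ) + 1 + y)) - f 0) := by ring
  have b1 : |f (1 / ((k:ℝ) + 1 + x)) - f (1 / ((k:ℝ) + 1 + y))| ≤
      L * |x - y| * (1 / ((k:ℝ) + 1 + x) * (1 / ((k:ℝ) + 1 + y))) := by
    refine (hf _ (inv_mem k hx) _ (inv_mem k hy)).trans (le_of_eq ?_)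
    have : 1 / ((k:ℝ) + 1 + x) - 1 / ((k:ℝ) + 1 + y) =
      (y - x) * (1 / ((k:ℝ) + 1 + x) * (1 / ((k:ℝ) + 1 + y))) := by
      field_simp; ring
    rw [this, abs_mul, abs_of_nonneg (by positivity :
      0 ≤ (1 / ((k:ℝ) + 1 + x) * (1 / ((k:ℝ) + 1 + y)))), abs_sub_comm]
    ring
  have b2 : |f (1 / ((k:ℝ) + 1 + y)) - f 0| ≤ L * (1 / ((k:ℝ) + 1 + y)) := by
    refine (hf _ (inv_mem k hy) 0 (by simp)).trans (le_of_eq ?_)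
    rw [sub_zero, abs_of_nonneg (by positivity)]
  have main : |pk k x * (f (1 / ((k:ℝ) + 1 + x)) - f 0)
      - pk k y * (f (1 / ((k:ℝ) + 1 + y)) - f 0)| ≤
      (L * |x - y|) * (pk k x * (1 / ((k:ℝ) + 1 + x) * (1 / ((k:ℝ) + 1 + y))))
      + L * (|pk k x - pk k y| * (1 / ((k:ℝ) + 1 + y))) := by
    rw [e]
    refine (abs_add_le _ _).trans ?_
    rw [abs_mul, abs_mul, abs_of_nonneg (pk_nonneg k hx0)]
    have c1 := mul_le_mul_of_nonneg_left b1 (pk_nonneg k hx0)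
    have c2 := mul_le_mul_of_nonneg_left b2 (abs_nonneg (pk k x - pk k y))
    linarith
  refine main.trans ?_
  have hD : 0 ≤ L * |x - y| := by positivity
  rcases Nat.eq_zero_or_pos k with h0 | h0
  · subst h0
    obtain ⟨q1, q2⟩ := pk_bound0 hx hy
    have c1 := mul_le_mul_of_nonneg_left q1 hD
    have c2 := mul_le_mul_of_nonneg_left q2 hL
    have : ck 0 = 3 / 4 := by simp [ck]
    rw [this]
    linarith
  · obtain ⟨q1, q2⟩ := pk_bound k h0 hx hy
    have c1 := mul_le_mul_of_nonneg_left q1 hD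
    have c2 := mul_le_mul_of_nonneg_left q2 hL
    have : ck k = 2 / (((k:ℝ) + 1) ^ 2 * ((k:ℝ) + 2) ^ 2) + 1 / (((k:ℝ) + 1) ^ 2 * ((k:ℝ) + 2)) := by
      unfold ck
      rw [if_neg (by omega)]
      field_simp
      ring
    rw [this]
    linarith

/-- The transfer operator. -/
noncomputable def Pop (f : ℝ → ℝ) (x : ℝ) : ℝ := ∑' k : ℕ, pk k x * f (1 / ((k:ℝ) + 1 + x))

lemma Pop_summable (f : ℝ → ℝ) (B : ℝ) (hB : ∀ x ∈ Set.Icc (0:ℝ) 1, |f x| ≤ B)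
    {x : ℝ} (hx : x ∈ Set.Icc (0:ℝ) 1) :
    Summable (fun k : ℕ => pk k x * f (1 / ((k:ℝ) + 1 + x))) := by
  refine Summable.of_norm_bounded ((pk_hasSum hx.1).summable.mul_right B) ?_
  intro k
  rw [norm_eq_abs, abs_mul, abs_of_nonneg (pk_nonneg k hx.1)]
  exact mul_le_mul_of_nonneg_left (hB _ (inv_mem k hx)) (pk_nonneg k hx.1)

lemma lip_bdd (f : ℝ → ℝ) (L : ℝ) (hL : 0 ≤ L)
    (hf : ∀ x ∈ Set.Icc (0:ℝ) 1, ∀ y ∈ Set.Icc (0:ℝ) 1, |f x - f y| ≤ L * |x - y|) :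
    ∀ x ∈ Set.Icc (0:ℝ) 1, |f x| ≤ |f 0| + L := by
  intro x hx
  have h := hf x hx 0 (by simp)
  rw [sub_zero, abs_of_nonneg hx.1] at h
  have h2 : L * x ≤ L := mul_le_of_le_one_right hL hx.2
  have h3 : |f x| ≤ |f x - f 0| + |f 0| := by
    have := abs_add_le (f x - f 0) (f 0)
    simpa using this
  linarith

lemma Pop_contr (f : ℝ → ℝ) (L : ℝ) (hL : 0 ≤ L)
    (hf : ∀ x ∈ Set.Icc (0:ℝ) 1, ∀ y ∈ Set.Icc (0:ℝ) 1, |f x - f y| ≤ L * |x - y|) :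
    ∀ x ∈ Set.Icc (0:ℝ) 1, ∀ y ∈ Set.Icc (0:ℝ) 1,
      |Pop f x - Pop f y| ≤ (49 / 50 * L) * |x - y| := by
  intro x hx y hy
  have hS : ∀ z ∈ Set.Icc (0:ℝ) 1,
      HasSum (fun k : ℕ => pk k z * (f (1 / ((k:ℝ) + 1 + z)) - f 0)) (Pop f z - f 0) := by
    intro z hz
    have h1 := (Pop_summable f _ (lip_bdd f L hL hf) hz).hasSum
    have h2 := (pk_hasSum hz.1).mul_right (f 0)
    have h3 := h1.sub h2
    rw [one_mul] at h3
    refine h3.congr_fun ?_ |> fun h => h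
    intro k; ring
  have h := ((hS x hx).sub (hS y hy)).tendsto_sum_nat.abs
  rw [sub_sub_sub_cancel_right] at h
  refine le_of_tendsto h (Eventually.of_forall fun N => ?_)
  calc _ ≤ ∑ k ∈ Finset.range N, |pk k x * (f (1 / ((k:ℝ) + 1 + x)) - f 0)
        - pk k y * (f (1 / ((k:ℝ) + 1 + y)) - f 0)| := Finset.abs_sum_le_sum_abs _ _
    _ ≤ ∑ k ∈ Finset.range N, ck k * (L * |x - y|) :=
        Finset.sum_le_sum fun k _ => term_bound f L hL hf k hx hy
    _ = (∑ k ∈ Finset.range N, ck k) * (L * |x - y|) := by rw [Finset.sum_mul]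
    _ ≤ 49 / 50 * (L * |x - y|) := by
        gcongr; exact ck_sum N
    _ = _ := by ring

end DV


namespace DV

/-- Density of the Gauss measure. -/
noncomputable def wt (x : ℝ) : ENNReal := ENNReal.ofReal (1 / (Real.log 2 * (1 + x)))

lemma wt_meas : Measurable wt := by
  unfold wt; fun_prop

/-- The Gauss measure. -/
noncomputable def gm : Measure ℝ := (volume.restrict (Set.Ioc (0:ℝ) 1)).withDensity wt

lemma lint_gm (F : ℝ → ENNReal) : ∫⁻ x, F x ∂gm = ∫⁻ x in Set.Ioc (0:ℝ) 1, wt x * F x := by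
  unfold gm
  rw [lintegral_withDensity_eq_lintegral_mul_non_measurable _ wt_meas]
  · rfl
  · exact Eventually.of_forall fun x => ENNReal.ofReal_lt_top

/-- Inverse branches. -/
noncomputable def br (k : ℕ) (u : ℝ) : ℝ := 1 / ((k:ℝ) + 1 + u)

lemma gaussMap_br (k : ℕ) {u : ℝ} (hu : u ∈ Set.Ico (0:ℝ) 1) : gaussMap (br k u) = u := by
  unfold gaussMap br
  rw [one_div, inv_inv]
  have : (k:ℝ) + 1 + u = u + ((k + 1 : ℕ) : ℝ) := by push_cast; ring
  rw [this, Int.fract_add_natCast, Int.fract_eq_self.mpr hu]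

lemma br_inv_floor (k : ℕ) {u : ℝ} (hu : u ∈ Set.Ico (0:ℝ) 1) : ⌊(br k u)⁻¹⌋ = (k:ℤ) + 1 := by
  unfold br
  rw [one_div, inv_inv, Int.floor_eq_iff]
  push_cast
  constructor <;> linarith [hu.1, hu.2]

lemma br_mem (k : ℕ) {u : ℝ} (hu : u ∈ Set.Ico (0:ℝ) 1) : br k u ∈ Set.Ioc (0:ℝ) 1 := by
  have h0 := hu.1
  unfold br
  refine ⟨by positivity, ?_⟩
  rw [div_le_one (by positivity)]
  have : (0:ℝ) ≤ k := Nat.cast_nonneg k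
  linarith

lemma br_union : Set.Ioc (0:ℝ) 1 = ⋃ k : ℕ, br k '' Set.Ico (0:ℝ) 1 := by
  ext x
  simp only [Set.mem_iUnion, Set.mem_image]
  constructor
  · intro hx
    have h1 : 1 ≤ x⁻¹ := (one_le_inv₀ hx.1).mpr hx.2
    have h2 : 1 ≤ ⌊x⁻¹⌋₊ := Nat.le_floor (by simpa using h1)
    refine ⟨⌊x⁻¹⌋₊ - 1, Int.fract x⁻¹, ⟨Int.fract_nonneg _, Int.fract_lt_one _⟩, ?_⟩
    unfold br
    have h3 : ((⌊x⁻¹⌋₊ - 1 : ℕ) : ℝ) + 1 + Int.fract x⁻¹ = x⁻¹ := by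
      rw [Nat.cast_sub h2]
      have := Nat.floor_le (by linarith : 0 ≤ x⁻¹)
      have h4 : ((⌊x⁻¹⌋₊ : ℕ) : ℝ) = ((⌊x⁻¹⌋ : ℤ) : ℝ) := by
        rw [natCast_floor_eq_intCast_floor (by linarith)]
      rw [h4]
      have := Int.floor_add_fract x⁻¹
      push_cast
      linarith
    rw [h3, one_div, inv_inv]
  · rintro ⟨k, u, hu, rfl⟩
    exact br_mem k hu

lemma br_injOn (k : ℕ) : Set.InjOn (br k) (Set.Ico (0:ℝ) 1) := by
  intro u hu v hv h
  rw [← gaussMap_br k hu, ← gaussMap_br k hv, h]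

lemma br_deriv (k : ℕ) {u : ℝ} (hu : 0 ≤ u) :
    HasDerivAt (br k) (-1 / ((k:ℝ) + 1 + u) ^ 2) u := by
  unfold br
  have h : HasDerivAt (fun u : ℝ => (k:ℝ) + 1 + u) 1 u := by
    simpa using (hasDerivAt_id u).const_add ((k:ℝ) + 1)
  have := h.inv (by positivity)
  simp only [one_div]
  exact this

lemma br_image_meas (k : ℕ) : MeasurableSet (br k '' Set.Ico (0:ℝ) 1) := by
  refine MeasurableSet.image_of_continuousOn_injOn measurableSet_Ico ?_ (br_injOn k)
  intro u hu
  exact (br_deriv k hu.1).continuousAt.continuousWithinAt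

lemma br_meas (k : ℕ) : Measurable (br k) := by
  unfold br; fun_prop

lemma pk_meas (k : ℕ) : Measurable (pk k) := by
  unfold pk; fun_prop

lemma gaussMap_meas : Measurable gaussMap := by
  unfold gaussMap; fun_prop

lemma duality (F G : ℝ → ENNReal) (hF : Measurable F) (hG : Measurable G) :
    ∫⁻ x, F x * G (gaussMap x) ∂gm =
      ∫⁻ u in Set.Ico (0:ℝ) 1, wt u * ((∑' k : ℕ, ENNReal.ofReal (pk k u) * F (br k u)) * G u) := by
  rw [lint_gm, br_union, lintegral_iUnion br_image_meas]
  · have h1 : ∀ k : ℕ, ∫⁻ x in br k '' Set.Ico (0:ℝ) 1, wt x * (F x * G (gaussMap x)) =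
        ∫⁻ u in Set.Ico (0:ℝ) 1, wt u * ((ENNReal.ofReal (pk k u) * F (br k u)) * G u) := by
      intro k
      rw [lintegral_image_eq_lintegral_abs_deriv_mul measurableSet_Ico
        (fun u hu => (br_deriv k hu.1).hasDerivWithinAt) (br_injOn k)]
      refine setLIntegral_congr_fun measurableSet_Ico ?_
      intro u hu
      have hu0 := hu.1
      simp only
      rw [gaussMap_br k hu]
      have e : ENNReal.ofReal |(-1 / ((k:ℝ) + 1 + u) ^ 2)| * wt (br k u) =
          wt u * ENNReal.ofReal (pk k u) := by
        unfold wt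
        have hl : 0 < Real.log 2 := Real.log_pos (by norm_num)
        rw [← ENNReal.ofReal_mul (abs_nonneg _), ← ENNReal.ofReal_mul (by positivity)]
        congr 1
        rw [neg_div, abs_neg, abs_of_nonneg (by positivity)]
        unfold br pk
        have : (k:ℝ) + 1 + u ≠ 0 := by positivity
        field_simp
        ring
      rw [← mul_assoc, e]
      ring
    simp_rw [h1]
    rw [← lintegral_tsum]
    · refine lintegral_congr fun u => ?_
      rw [ENNReal.tsum_mul_left, ENNReal.tsum_mul_right]
    · intro k
      have := br_meas k
      have := pk_meas k
      have := wt_meas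
      refine Measurable.aemeasurable ?_
      refine Measurable.mul ‹_› (Measurable.mul (Measurable.mul ?_ (hF.comp ‹_›)) hG)
      exact ENNReal.measurable_ofReal.comp ‹_›
  · intro i j hij
    refine Set.disjoint_left.mpr ?_
    rintro x ⟨u, hu, rfl⟩ ⟨v, hv, h⟩
    have h1 := br_inv_floor i hu
    rw [← h, br_inv_floor j hv] at h1
    apply hij
    omega

lemma lint_gm' (F : ℝ → ENNReal) : ∫⁻ x, F x ∂gm = ∫⁻ x in Set.Ico (0:ℝ) 1, wt x * F x := by
  rw [lint_gm, restrict_Ico_eq_restrict_Ioc]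

lemma duality' (F G H : ℝ → ENNReal) (hF : Measurable F) (hG : Measurable G)
    (h : ∀ u ∈ Set.Ico (0:ℝ) 1, ∑' k : ℕ, ENNReal.ofReal (pk k u) * F (br k u) = H u) :
    ∫⁻ x, F x * G (gaussMap x) ∂gm = ∫⁻ u, H u * G u ∂gm := by
  rw [duality F G hF hG, lint_gm']
  refine setLIntegral_congr_fun measurableSet_Ico ?_
  intro u hu
  simp only
  rw [h u hu]

lemma inv_one (G : ℝ → ENNReal) (hG : Measurable G) :
    ∫⁻ x, G (gaussMap x) ∂gm = ∫⁻ x, G x ∂gm := by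
  have := duality' (fun _ => 1) G (fun _ => 1) measurable_const hG ?_
  · simpa using this
  · intro u hu
    simp only [mul_one]
    rw [← ENNReal.ofReal_tsum_of_nonneg (fun k => pk_nonneg k hu.1) (pk_hasSum hu.1).summable,
      (pk_hasSum hu.1).tsum_eq, ENNReal.ofReal_one]

lemma iter_meas (n : ℕ) : Measurable (gaussMap^[n]) := gaussMap_meas.iterate n

lemma inv_iter (G : ℝ → ENNReal) (hG : Measurable G) (n : ℕ) :
    ∫⁻ x, G (gaussMap^[n] x) ∂gm = ∫⁻ x, G x ∂gm := by
  induction n with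
  | zero => rfl
  | succ n ih =>
    simp_rw [Function.iterate_succ_apply]
    rw [inv_one (fun x => G (gaussMap^[n] x)) (hG.comp (iter_meas n)), ih]

/-- measure of the sets `[a ≥ m]` -/
lemma gm_Ioc (m : ℕ) (hm : 1 ≤ m) :
    gm (Set.Ioc 0 (1 / (m:ℝ))) = ENNReal.ofReal (Real.log (1 + 1 / m) / Real.log 2) := by
  have hm' : (1:ℝ) ≤ m := by exact_mod_cast hm
  have hm1 : 1 / (m:ℝ) ≤ 1 := by rw [div_le_one (by positivity)]; exact hm'
  have hl : 0 < Real.log 2 := Real.log_pos (by norm_num)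
  have hm0 : 0 ≤ 1 / (m:ℝ) := by positivity
  unfold gm
  rw [withDensity_apply _ measurableSet_Ioc, Measure.restrict_restrict measurableSet_Ioc,
    Set.inter_eq_left.mpr (Set.Ioc_subset_Ioc_right hm1)]
  have hd : ∀ x ∈ Set.uIcc 0 (1 / (m:ℝ)),
      HasDerivAt (fun x : ℝ => Real.log (1 + x) / Real.log 2) (1 / (Real.log 2 * (1 + x))) x := by
    intro x hx
    rw [Set.uIcc_of_le hm0] at hx
    have h1 : HasDerivAt (fun x : ℝ => 1 + x) 1 x := by
      simpa using (hasDerivAt_id x).const_add (1:ℝ)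
    have hx0 := hx.1
    have h2 := (h1.log (by positivity)).div_const (Real.log 2)
    refine h2.congr_deriv ?_
    field_simp
  have hc : ContinuousOn (fun x : ℝ => 1 / (Real.log 2 * (1 + x))) (Set.uIcc 0 (1 / (m:ℝ))) := by
    rw [Set.uIcc_of_le hm0]
    refine ContinuousOn.div continuousOn_const (by fun_prop) ?_
    intro x hx
    have := hx.1
    positivity
  have hi := intervalIntegral.integral_eq_sub_of_hasDerivAt hd hc.intervalIntegrable
  rw [intervalIntegral.integral_of_le hm0] at hi
  unfold wt
  rw [← ofReal_integral_eq_lintegral_ofReal, hi]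
  · simp
  · exact (intervalIntegrable_iff_integrableOn_Ioc_of_le hm0).mp hc.intervalIntegrable
  · refine (ae_restrict_iff' measurableSet_Ioc).mpr (Eventually.of_forall fun x hx => ?_)
    have := hx.1
    simp only [Pi.zero_apply]
    positivity

lemma gm_compl : gm (Set.Ioc (0:ℝ) 1)ᶜ = 0 := by
  unfold gm
  refine withDensity_absolutelyContinuous _ _ ?_
  rw [Measure.restrict_apply measurableSet_Ioc.compl]
  simp

instance gm_prob : IsProbabilityMeasure gm := by
  constructor
  rw [← measure_add_measure_compl (measurableSet_Ioc : MeasurableSet (Set.Ioc (0:ℝ) 1)), gm_compl]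
  have := gm_Ioc 1 le_rfl
  simp only [Nat.cast_one, div_one] at this
  rw [this]
  have hl : 0 < Real.log 2 := Real.log_pos (by norm_num)
  rw [one_add_one_eq_two, div_self hl.ne', ENNReal.ofReal_one, add_zero]

lemma gm_ac : (volume.restrict (Set.Icc (0:ℝ) 1)) ≪ gm := by
  rw [← restrict_Ioc_eq_restrict_Icc]
  unfold gm
  refine withDensity_absolutelyContinuous' wt_meas.aemeasurable ?_
  refine (ae_restrict_iff' measurableSet_Ioc).mpr (Eventually.of_forall fun x hx => ?_)
  unfold wt
  have hl : 0 < Real.log 2 := Real.log_pos (by norm_num)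
  have := hx.1
  refine (ENNReal.ofReal_pos.mpr ?_).ne'
  positivity

end DV


namespace DV

/-- clamp to the unit interval -/
noncomputable def clamp (x : ℝ) : ℝ := max 0 (min x 1)

lemma clamp_mem (x : ℝ) : clamp x ∈ Set.Icc (0:ℝ) 1 :=
  ⟨le_max_left _ _, max_le zero_le_one (min_le_right _ _)⟩

lemma clamp_eq {x : ℝ} (hx : x ∈ Set.Icc (0:ℝ) 1) : clamp x = x := by
  unfold clamp; rw [min_eq_left hx.2, max_eq_right hx.1]

lemma Pop_clamp_meas (f : ℝ → ℝ) (L : ℝ) (hL : 0 ≤ L)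
    (hf : ∀ x ∈ Set.Icc (0:ℝ) 1, ∀ y ∈ Set.Icc (0:ℝ) 1, |f x - f y| ≤ L * |x - y|) :
    Measurable (fun x => Pop f (clamp x)) := by
  have h := Pop_contr f L hL hf
  have hc : ContinuousOn (Pop f) (Set.Icc (0:ℝ) 1) := by
    refine (LipschitzOnWith.of_dist_le_mul (K := Real.toNNReal (49 / 50 * L)) ?_).continuousOn
    intro x hx y hy
    rw [Real.dist_eq, Real.dist_eq, Real.coe_toNNReal _ (by positivity)]
    exact h x hx y hy
  refine Continuous.measurable ?_
  refine hc.comp_continuous ?_ clamp_mem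
  unfold clamp
  fun_prop

lemma gm_ae : ∀ᵐ x ∂gm, x ∈ Set.Ioc (0:ℝ) 1 := by
  rw [ae_iff]
  exact gm_compl

lemma Pop_dual (f : ℝ → ℝ) (hm : Measurable f) (L : ℝ) (hL : 0 ≤ L)
    (h0 : ∀ x ∈ Set.Icc (0:ℝ) 1, 0 ≤ f x)
    (hf : ∀ x ∈ Set.Icc (0:ℝ) 1, ∀ y ∈ Set.Icc (0:ℝ) 1, |f x - f y| ≤ L * |x - y|)
    (G : ℝ → ENNReal) (hG : Measurable G) :
    ∫⁻ x, ENNReal.ofReal (f x) * G (gaussMap x) ∂gm =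
      ∫⁻ x, ENNReal.ofReal (Pop f (clamp x)) * G x ∂gm := by
  refine duality' (fun x => ENNReal.ofReal (f x)) G
    (fun x => ENNReal.ofReal (Pop f (clamp x))) (ENNReal.measurable_ofReal.comp hm) hG ?_
  intro u hu
  have hu' : u ∈ Set.Icc (0:ℝ) 1 := ⟨hu.1, hu.2.le⟩
  rw [clamp_eq hu']
  unfold Pop
  rw [ENNReal.ofReal_tsum_of_nonneg]
  · refine tsum_congr fun k => ?_
    rw [ENNReal.ofReal_mul (pk_nonneg k hu.1)]
    rfl
  · intro k
    exact mul_nonneg (pk_nonneg k hu.1) (h0 _ (inv_mem k hu'))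
  · exact Pop_summable f _ (lip_bdd f L hL hf) hu'

lemma keyK (n : ℕ) : ∀ (f : ℝ → ℝ) (L : ℝ), Measurable f → 0 ≤ L →
    (∀ x ∈ Set.Icc (0:ℝ) 1, 0 ≤ f x) →
    (∀ x ∈ Set.Icc (0:ℝ) 1, ∀ y ∈ Set.Icc (0:ℝ) 1, |f x - f y| ≤ L * |x - y|) →
    ∀ G : ℝ → ENNReal, Measurable G →
    ∫⁻ x, ENNReal.ofReal (f x) * G (gaussMap^[n] x) ∂gm ≤
      (∫⁻ x, ENNReal.ofReal (f x) ∂gm + ENNReal.ofReal (L * (49 / 50) ^ n)) * ∫⁻ x, G x ∂gm := by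
  induction n with
  | zero =>
    intro f L hm hL h0 hf G hG
    rw [← lintegral_const_mul _ hG]
    refine lintegral_mono_ae ?_
    filter_upwards [gm_ae] with x hx
    simp only [Function.iterate_zero, id_eq, pow_zero, mul_one]
    gcongr
    have hx' : x ∈ Set.Icc (0:ℝ) 1 := ⟨hx.1.le, hx.2⟩
    have h1 : ∫⁻ _y, ENNReal.ofReal (f x) ∂gm ≤
        ∫⁻ y, (ENNReal.ofReal (f y) + ENNReal.ofReal L) ∂gm := by
      refine lintegral_mono_ae ?_
      filter_upwards [gm_ae] with y hy
      have hy' : y ∈ Set.Icc (0:ℝ) 1 := ⟨hy.1.le, hy.2⟩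
      rw [← ENNReal.ofReal_add (h0 y hy') hL]
      refine ENNReal.ofReal_le_ofReal ?_
      have h2 := (le_abs_self _).trans (hf x hx' y hy')
      have h3 : |x - y| ≤ 1 := by
        rw [abs_le]; constructor <;> linarith [hx'.1, hx'.2, hy'.1, hy'.2]
      have h4 : L * |x - y| ≤ L := mul_le_of_le_one_right hL h3
      linarith
    rw [lintegral_add_right _ measurable_const] at h1
    simpa using h1
  | succ n ih =>
    intro f L hm hL h0 hf G hG
    simp_rw [Function.iterate_succ_apply]
    rw [Pop_dual f hm L hL h0 hf (fun x => G (gaussMap^[n] x)) (hG.comp (iter_meas n))]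
    have hI := Pop_dual f hm L hL h0 hf (fun _ => 1) measurable_const
    simp only [mul_one] at hI
    rw [hI]
    have e : L * (49 / 50) ^ (n + 1) = (49 / 50 * L) * (49 / 50) ^ n := by ring
    rw [e]
    refine ih (fun x => Pop f (clamp x)) (49 / 50 * L) (Pop_clamp_meas f L hL hf) (by positivity)
      ?_ ?_ G hG
    · intro x _
      refine tsum_nonneg fun k => mul_nonneg (pk_nonneg k (clamp_mem x).1) ?_
      exact h0 _ (inv_mem k (clamp_mem x))
    · intro x hx y hy
      rw [clamp_eq hx, clamp_eq hy]
      exact Pop_contr f L hL hf x hx y hy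

/-- First digit. -/
noncomputable def dig (x : ℝ) : ℕ := (⌊x⁻¹⌋).toNat

lemma dig_meas : Measurable dig := by
  unfold dig
  exact (measurable_of_countable Int.toNat).comp (Int.measurable_floor.comp measurable_inv)

lemma cfCoeff_eq (r : ℝ) (n : ℕ) : cfCoeff r n = dig (gaussMap^[n] r) := rfl

lemma dig_br (k : ℕ) {u : ℝ} (hu : u ∈ Set.Ico (0:ℝ) 1) : dig (br k u) = k + 1 := by
  unfold dig
  rw [br_inv_floor k hu]; omega

lemma dig_ge (m : ℕ) (hm : 1 ≤ m) {x : ℝ} (hx : x ∈ Set.Ioc (0:ℝ) 1) :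
    m ≤ dig x ↔ x ∈ Set.Ioc 0 (1 / (m:ℝ)) := by
  have hm' : (0:ℝ) < m := by exact_mod_cast hm
  unfold dig
  have h1 : m ≤ (⌊x⁻¹⌋).toNat ↔ (m:ℤ) ≤ ⌊x⁻¹⌋ := by omega
  rw [h1, Int.le_floor]
  push_cast
  rw [le_inv_comm₀ hm' hx.1, one_div]
  exact ⟨fun h => ⟨hx.1, h⟩, fun h => h.2⟩

lemma gm_dig (m : ℕ) (hm : 1 ≤ m) :
    gm {x | m ≤ dig x} = ENNReal.ofReal (Real.log (1 + 1 / m) / Real.log 2) := by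
  rw [← gm_Ioc m hm]
  refine measure_congr ?_
  filter_upwards [gm_ae] with x hx
  exact propext (dig_ge m hm hx)

lemma dig_set_meas (m : ℕ) : MeasurableSet {x | m ≤ dig x} :=
  dig_meas (measurableSet_Ici (a := m))

lemma min_sum (n t : ℕ) : min n t = ∑ m ∈ Finset.range t, (if m + 1 ≤ n then 1 else 0) := by
  induction t with
  | zero => simp
  | succ t ih =>
    rw [Finset.sum_range_succ, ← ih]
    split_ifs <;> omega

lemma min_sq_sum (n t : ℕ) :
    (min n t) ^ 2 = ∑ m ∈ Finset.range t, (2 * m + 1) * (if m + 1 ≤ n then 1 else 0) := by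
  induction t with
  | zero => simp
  | succ t ih =>
    rw [Finset.sum_range_succ, ← ih]
    split_ifs with h
    · rw [min_eq_right h, min_eq_right (by omega)]; ring
    · rw [min_eq_left (by omega), min_eq_left (by omega)]; simp

lemma lint_ind (m : ℕ) : ∫⁻ x, (if m + 1 ≤ dig x then (1:ENNReal) else 0) ∂gm =
    ENNReal.ofReal (Real.log (1 + 1 / ((m:ℝ) + 1)) / Real.log 2) := by
  have : (fun x => if m + 1 ≤ dig x then (1:ENNReal) else 0) =
      Set.indicator {x | m + 1 ≤ dig x} 1 := by
    ext x; simp [Set.indicator_apply]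
  rw [this, lintegral_indicator_one (dig_set_meas _), gm_dig _ (by omega)]
  push_cast; rfl

lemma ind_meas (m : ℕ) : Measurable (fun x => if m + 1 ≤ dig x then (1:ENNReal) else 0) :=
  Measurable.ite (dig_set_meas _) measurable_const measurable_const

lemma log_term_nonneg (m : ℕ) : 0 ≤ Real.log (1 + 1 / ((m:ℝ) + 1)) / Real.log 2 := by
  have hl : 0 < Real.log 2 := Real.log_pos (by norm_num)
  refine div_nonneg (Real.log_nonneg ?_) hl.le
  have : 0 ≤ 1 / ((m:ℝ) + 1) := by positivity
  linarith

lemma log_term_le (m : ℕ) : Real.log (1 + 1 / ((m:ℝ) + 1)) / Real.log 2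
    ≤ 1 / ((m:ℝ) + 1) / Real.log 2 := by
  have hl : 0 < Real.log 2 := Real.log_pos (by norm_num)
  have : 0 < 1 + 1 / ((m:ℝ) + 1) := by positivity
  have := Real.log_le_sub_one_of_pos this
  gcongr
  linarith

lemma log_sum (t : ℕ) : ∑ m ∈ Finset.range t, Real.log (1 + 1 / ((m:ℝ) + 1)) / Real.log 2 =
    Real.log (t + 1) / Real.log 2 := by
  induction t with
  | zero => simp
  | succ t ih =>
    rw [Finset.sum_range_succ, ih, ← add_div, ← Real.log_mul (by positivity) (by positivity)]
    congr 2
    push_cast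
    field_simp

/-- truncated mean -/
noncomputable def mean (t : ℕ) : ℝ := Real.log (t + 1) / Real.log 2

lemma mean_nonneg (t : ℕ) : 0 ≤ mean t := by
  unfold mean
  have hl : 0 < Real.log 2 := Real.log_pos (by norm_num)
  refine div_nonneg (Real.log_nonneg ?_) hl.le
  have : (0:ℝ) ≤ t := Nat.cast_nonneg t
  linarith

/-- truncated digit -/
noncomputable def psi (t : ℕ) (x : ℝ) : ENNReal := ((min (dig x) t : ℕ) : ENNReal)

lemma psi_meas (t : ℕ) : Measurable (psi t) := by
  unfold psi
  exact (measurable_of_countable (fun n : ℕ => ((min n t : ℕ) : ENNReal))).comp dig_meas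

lemma lint_psi (t : ℕ) : ∫⁻ x, psi t x ∂gm = ENNReal.ofReal (mean t) := by
  unfold psi mean
  simp_rw [min_sum]
  push_cast
  rw [lintegral_finsetSum]
  · simp_rw [lint_ind]
    rw [← ENNReal.ofReal_sum_of_nonneg (fun m _ => log_term_nonneg m), log_sum]
  · intro m _; exact ind_meas m

lemma lint_psi_sq (t : ℕ) : ∫⁻ x, psi t x ^ 2 ∂gm ≤ ENNReal.ofReal (2 * t / Real.log 2) := by
  have hl : 0 < Real.log 2 := Real.log_pos (by norm_num)
  unfold psi
  have e : ∀ x, ((min (dig x) t : ℕ) : ENNReal) ^ 2 =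
      ∑ m ∈ Finset.range t, ENNReal.ofReal (2 * m + 1) * (if m + 1 ≤ dig x then 1 else 0) := by
    intro x
    rw [← Nat.cast_pow, min_sq_sum]
    push_cast
    refine Finset.sum_congr rfl fun m _ => ?_
    congr 1
    have : (2 * (m:ℝ) + 1) = ((2 * m + 1 : ℕ) : ℝ) := by push_cast; ring
    rw [this, ENNReal.ofReal_natCast]
    push_cast; rfl
  simp_rw [e]
  rw [lintegral_finsetSum]
  · simp_rw [lintegral_const_mul _ (ind_meas _), lint_ind]
    have e2 : ∀ m : ℕ, ENNReal.ofReal (2 * m + 1) *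
        ENNReal.ofReal (Real.log (1 + 1 / ((m:ℝ) + 1)) / Real.log 2) ≤
        ENNReal.ofReal (2 / Real.log 2) := by
      intro m
      rw [← ENNReal.ofReal_mul (by positivity)]
      refine ENNReal.ofReal_le_ofReal ?_
      refine (mul_le_mul_of_nonneg_left (log_term_le m) (by positivity)).trans ?_
      rw [← mul_div_assoc]
      gcongr
      rw [mul_one_div, div_le_iff₀ (by positivity)]
      linarith
    refine (Finset.sum_le_sum fun m _ => e2 m).trans (le_of_eq ?_)
    rw [Finset.sum_const, Finset.card_range, nsmul_eq_mul, ← ENNReal.ofReal_natCast,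
      ← ENNReal.ofReal_mul (by positivity)]
    congr 1; ring
  · intro m _; exact (ind_meas m).const_mul _

/-- Image of the truncated digit under the transfer operator. -/
noncomputable def Hf (t : ℕ) (x : ℝ) : ℝ := ∑ m ∈ Finset.range t, (1 + x) / ((m:ℝ) + 1 + x)

/-- Harmonic sums. -/
noncomputable def Lf (t : ℕ) : ℝ := ∑ m ∈ Finset.range t, 1 / ((m:ℝ) + 1)

lemma Lf_nonneg (t : ℕ) : 0 ≤ Lf t := Finset.sum_nonneg fun m _ => by positivity

lemma Hf_meas (t : ℕ) : Measurable (Hf t) := by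
  unfold Hf; fun_prop

lemma Hf_nonneg (t : ℕ) : ∀ x ∈ Set.Icc (0:ℝ) 1, 0 ≤ Hf t x := by
  intro x hx
  have := hx.1
  exact Finset.sum_nonneg fun m _ => by positivity

lemma Hf_lip (t : ℕ) : ∀ x ∈ Set.Icc (0:ℝ) 1, ∀ y ∈ Set.Icc (0:ℝ) 1,
    |Hf t x - Hf t y| ≤ Lf t * |x - y| := by
  intro x hx y hy
  have hx0 := hx.1
  have hy0 := hy.1
  unfold Hf Lf
  rw [← Finset.sum_sub_distrib, Finset.sum_mul]
  refine (Finset.abs_sum_le_sum_abs _ _).trans (Finset.sum_le_sum fun m _ => ?_)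
  have e : (1 + x) / ((m:ℝ) + 1 + x) - (1 + y) / ((m:ℝ) + 1 + y) =
      (m / (((m:ℝ) + 1 + x) * ((m:ℝ) + 1 + y))) * (x - y) := by
    field_simp
    ring
  rw [e, abs_mul, abs_of_nonneg (by positivity)]
  refine mul_le_mul_of_nonneg_right ?_ (abs_nonneg _)
  rw [div_le_div_iff₀ (by positivity) (by positivity)]
  have hm : (0:ℝ) ≤ m := Nat.cast_nonneg m
  have a1 : ((m:ℝ) + 1) * ((m:ℝ) + 1) ≤ ((m:ℝ) + 1 + x) * ((m:ℝ) + 1 + y) :=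
    mul_le_mul (by linarith) (by linarith) (by positivity) (by positivity)
  nlinarith

lemma psi_dual (t : ℕ) (G : ℝ → ENNReal) (hG : Measurable G) :
    ∫⁻ x, psi t x * G (gaussMap x) ∂gm = ∫⁻ x, ENNReal.ofReal (Hf t x) * G x ∂gm := by
  refine duality' (psi t) G (fun x => ENNReal.ofReal (Hf t x)) (psi_meas t) hG ?_
  intro u hu
  have hs : HasSum (fun k : ℕ => ∑ m ∈ Finset.range t, (if m + 1 ≤ k + 1 then pk k u else 0))
      (Hf t u) := by
    unfold Hf
    refine hasSum_sum fun m _ => ?_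
    have := pk_hasSum_ge (m + 1) (by omega) hu.1
    rw [Nat.cast_add, Nat.cast_one] at this
    exact this
  rw [← hs.tsum_eq, ENNReal.ofReal_tsum_of_nonneg _ hs.summable]
  · refine tsum_congr fun k => ?_
    unfold psi
    rw [dig_br k hu, ← ENNReal.ofReal_natCast, ← ENNReal.ofReal_mul (pk_nonneg k hu.1), min_sum]
    congr 1
    push_cast
    rw [Finset.mul_sum]
    refine Finset.sum_congr rfl fun m _ => ?_
    split_ifs <;> simp
  · intro k
    refine Finset.sum_nonneg fun m _ => ?_
    split_ifs
    · exact pk_nonneg k hu.1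
    · exact le_rfl

lemma psi_corr (t d : ℕ) : ∫⁻ x, psi t x * psi t (gaussMap^[d + 1] x) ∂gm ≤
    ENNReal.ofReal ((mean t + Lf t * (49 / 50) ^ d) * mean t) := by
  simp_rw [Function.iterate_succ_apply]
  rw [psi_dual t (fun x => psi t (gaussMap^[d] x)) ((psi_meas t).comp (iter_meas d))]
  have hI := psi_dual t (fun _ => 1) measurable_const
  simp only [mul_one] at hI
  have h := keyK d (Hf t) (Lf t) (Hf_meas t) (Lf_nonneg t) (Hf_nonneg t) (Hf_lip t)
    (psi t) (psi_meas t)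
  rw [← hI, lint_psi] at h
  refine h.trans (le_of_eq ?_)
  have := mean_nonneg t
  have := Lf_nonneg t
  rw [← ENNReal.ofReal_add (by positivity) (by positivity), ← ENNReal.ofReal_mul (by positivity)]

lemma pair_bound (s : ℕ) (hs : 1 ≤ s) (d : ℕ) :
    gm {x | s ≤ dig x ∧ s ≤ dig (gaussMap^[d + 1] x)} ≤
      ENNReal.ofReal (2 / (Real.log 2 * (s:ℝ) ^ 2)) := by
  have hl : 0 < Real.log 2 := Real.log_pos (by norm_num)
  have hs' : (0:ℝ) < s := by exact_mod_cast hs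
  set I : ℝ → ENNReal := fun x => if s ≤ dig x then 1 else 0 with hI
  have hIm : Measurable I := Measurable.ite (dig_set_meas _) measurable_const measurable_const
  have h1 : gm {x | s ≤ dig x ∧ s ≤ dig (gaussMap^[d + 1] x)} =
      ∫⁻ x, I x * I (gaussMap^[d] (gaussMap x)) ∂gm := by
    rw [← lintegral_indicator_one]
    · refine lintegral_congr fun x => ?_
      rw [← Function.iterate_succ_apply, hI]
      by_cases h : s ≤ dig x <;> by_cases h' : s ≤ dig (gaussMap^[d + 1] x) <;>
        simp only [Set.indicator_apply, Set.mem_ofPred_eq, Pi.one_apply, h, h', if_true, if_false,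
          and_self, and_true, and_false, mul_one, mul_zero]
    · exact (dig_set_meas s).inter ((iter_meas (d + 1)) (dig_set_meas s))
  rw [h1, duality' I (fun x => I (gaussMap^[d] x)) (fun u => ENNReal.ofReal ((1 + u) / (s + u))) hIm
    (hIm.comp (iter_meas d))]
  · have h2 : ∫⁻ u, ENNReal.ofReal ((1 + u) / (s + u)) * I (gaussMap^[d] u) ∂gm ≤
        ∫⁻ u, ENNReal.ofReal (2 / s) * I (gaussMap^[d] u) ∂gm := by
      refine lintegral_mono_ae ?_
      filter_upwards [gm_ae] with u hu
      gcongr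
      · linarith [hu.2]
      · linarith [hu.1]
    refine h2.trans ?_
    have h5 : Measurable (fun u => I (gaussMap^[d] u)) := hIm.comp (iter_meas d)
    rw [lintegral_const_mul _ h5, inv_iter I hIm]
    have h3 : ∫⁻ x, I x ∂gm = gm {x | s ≤ dig x} := by
      rw [← lintegral_indicator_one (dig_set_meas s)]
      refine lintegral_congr fun x => ?_
      simp [hI, Set.indicator_apply]
    rw [h3, gm_dig s hs, ← ENNReal.ofReal_mul (by positivity)]
    refine ENNReal.ofReal_le_ofReal ?_
    have h4 := Real.log_le_sub_one_of_pos (by positivity : 0 < 1 + 1 / (s:ℝ))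
    calc _ ≤ 2 / (s:ℝ) * (1 / s / Real.log 2) := by gcongr; linarith
      _ = _ := by field_simp
  · intro u hu
    have hS := pk_hasSum_ge s hs hu.1
    rw [← hS.tsum_eq, ENNReal.ofReal_tsum_of_nonneg _ hS.summable]
    · refine tsum_congr fun k => ?_
      simp only [hI, dig_br k hu]
      split_ifs <;> simp
    · intro k
      split_ifs
      · exact pk_nonneg k hu.1
      · exact le_rfl

end DV


namespace DV

/-- truncated digits as real random variables -/
noncomputable def Y (t i : ℕ) (x : ℝ) : ℝ := ((min (cfCoeff x i) t : ℕ) : ℝ)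

lemma Y_nonneg (t i : ℕ) (x : ℝ) : 0 ≤ Y t i x := Nat.cast_nonneg _

lemma Y_le (t i : ℕ) (x : ℝ) : Y t i x ≤ t := by
  unfold Y; exact_mod_cast min_le_right _ _

lemma ofReal_Y (t i : ℕ) (x : ℝ) : ENNReal.ofReal (Y t i x) = psi t (gaussMap^[i] x) := by
  unfold Y psi
  rw [ENNReal.ofReal_natCast, cfCoeff_eq]

lemma Y_meas (t i : ℕ) : Measurable (Y t i) := by
  unfold Y
  have : Measurable (fun x => cfCoeff x i) := dig_meas.comp (iter_meas i)
  exact (measurable_of_countable (fun n : ℕ => ((min n t : ℕ) : ℝ))).comp this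

lemma bdd_int (f : ℝ → ℝ) (hf : Measurable f) (C : ℝ) (hC : ∀ x, |f x| ≤ C) : Integrable f gm :=
  Integrable.of_bound hf.aestronglyMeasurable C (Eventually.of_forall hC)

lemma E1 (t i : ℕ) : ∫ x, Y t i x ∂gm = mean t := by
  rw [integral_eq_lintegral_of_nonneg_ae (Eventually.of_forall (Y_nonneg t i))
    (Y_meas t i).aestronglyMeasurable]
  simp_rw [ofReal_Y]
  rw [inv_iter _ (psi_meas t), lint_psi, ENNReal.toReal_ofReal (mean_nonneg t)]

lemma E2 (t i : ℕ) : ∫ x, Y t i x * Y t i x ∂gm ≤ 2 * t / Real.log 2 := by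
  have hl : 0 < Real.log 2 := Real.log_pos (by norm_num)
  rw [integral_eq_lintegral_of_nonneg_ae
    (Eventually.of_forall fun x => mul_nonneg (Y_nonneg t i x) (Y_nonneg t i x))
    ((Y_meas t i).mul (Y_meas t i)).aestronglyMeasurable]
  refine ENNReal.toReal_le_of_le_ofReal (by positivity) ?_
  simp_rw [ENNReal.ofReal_mul (Y_nonneg _ _ _), ofReal_Y, ← pow_two]
  rw [inv_iter (fun x => psi t x ^ 2) ((psi_meas t).pow_const 2)]
  exact lint_psi_sq t

lemma E3 (t i d : ℕ) : ∫ x, Y t i x * Y t (i + d + 1) x ∂gm ≤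
    (mean t + Lf t * (49 / 50) ^ d) * mean t := by
  have := mean_nonneg t
  have := Lf_nonneg t
  rw [integral_eq_lintegral_of_nonneg_ae
    (Eventually.of_forall fun x => mul_nonneg (Y_nonneg t i x) (Y_nonneg t (i + d + 1) x))
    ((Y_meas t i).mul (Y_meas t (i + d + 1))).aestronglyMeasurable]
  refine ENNReal.toReal_le_of_le_ofReal (by positivity) ?_
  simp_rw [ENNReal.ofReal_mul (Y_nonneg _ _ _), ofReal_Y]
  have e : ∀ x, gaussMap^[i + d + 1] x = gaussMap^[d + 1] (gaussMap^[i] x) := by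
    intro x
    rw [show i + d + 1 = d + 1 + i by omega, Function.iterate_add_apply]
  simp_rw [e]
  rw [inv_iter (fun x => psi t x * psi t (gaussMap^[d + 1] x))
    ((psi_meas t).mul ((psi_meas t).comp (iter_meas (d + 1))))]
  exact psi_corr t d

/-- centered variables -/
noncomputable def W (t i : ℕ) (x : ℝ) : ℝ := Y t i x - mean t

lemma W_meas (t i : ℕ) : Measurable (W t i) := (Y_meas t i).sub_const _

lemma W_bdd (t i : ℕ) (x : ℝ) : |W t i x| ≤ t + mean t := by
  unfold W
  rw [abs_le]
  have := Y_nonneg t i x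
  have := Y_le t i x
  have := mean_nonneg t
  constructor <;> linarith

lemma WW_int (t i j : ℕ) : Integrable (fun x => W t i x * W t j x) gm := by
  refine bdd_int _ ((W_meas t i).mul (W_meas t j)) ((t + mean t) * (t + mean t)) fun x => ?_
  rw [abs_mul]
  exact mul_le_mul (W_bdd t i x) (W_bdd t j x) (abs_nonneg _) ((abs_nonneg _).trans (W_bdd t i x))

lemma Y_int (t i : ℕ) : Integrable (Y t i) gm :=
  bdd_int _ (Y_meas t i) t fun x => by rw [abs_of_nonneg (Y_nonneg t i x)]; exact Y_le t i x

lemma YY_int (t i j : ℕ) : Integrable (fun x => Y t i x * Y t j x) gm := by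
  refine bdd_int _ ((Y_meas t i).mul (Y_meas t j)) (t * t) fun x => ?_
  rw [abs_of_nonneg (mul_nonneg (Y_nonneg t i x) (Y_nonneg t j x))]
  exact mul_le_mul (Y_le t i x) (Y_le t j x) (Y_nonneg t j x) (Nat.cast_nonneg t)

lemma W_cov (t i j : ℕ) : ∫ x, W t i x * W t j x ∂gm =
    ∫ x, Y t i x * Y t j x ∂gm - mean t * mean t := by
  have e : ∀ x, W t i x * W t j x =
      Y t i x * Y t j x - mean t * Y t i x - mean t * Y t j x + mean t * mean t := by
    intro x; unfold W; ring
  simp_rw [e]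
  rw [integral_add, integral_sub, integral_sub, integral_const_mul, integral_const_mul, E1, E1]
  · simp
  · exact YY_int t i j
  · exact (Y_int t i).const_mul _
  · exact (YY_int t i j).sub ((Y_int t i).const_mul _)
  · exact (Y_int t j).const_mul _
  · exact ((YY_int t i j).sub ((Y_int t i).const_mul _)).sub ((Y_int t j).const_mul _)
  · exact integrable_const _

lemma geo_le (n : ℕ) : ∑ i ∈ Finset.range n, (49 / 50 : ℝ) ^ (n - 1 - i) ≤ 50 := by
  rw [Finset.sum_range_reflect (fun i => (49 / 50 : ℝ) ^ i) n, geom_sum_eq (by norm_num)]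
  have : 0 ≤ (49 / 50 : ℝ) ^ n := by positivity
  rw [div_le_iff_of_neg (by norm_num)]
  linarith

lemma variance_bound (t n : ℕ) : ∫ x, (∑ i ∈ Finset.range n, W t i x) ^ 2 ∂gm ≤
    n * (2 * t / Real.log 2 + 100 * (Lf t * mean t)) := by
  induction n with
  | zero => simp
  | succ n ih =>
    have e : ∀ x, (∑ i ∈ Finset.range (n + 1), W t i x) ^ 2 =
        (∑ i ∈ Finset.range n, W t i x) ^ 2 + 2 * (∑ i ∈ Finset.range n, W t i x * W t n x)
          + W t n x * W t n x := by
      intro x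
      rw [Finset.sum_range_succ, ← Finset.sum_mul]; ring
    have hi1 : Integrable (fun x => (∑ i ∈ Finset.range n, W t i x) ^ 2) gm := by
      simp_rw [pow_two, Finset.sum_mul_sum]
      exact integrable_finsetSum _ fun i _ => integrable_finsetSum _ fun j _ => WW_int t i j
    have hi2 : Integrable (fun x => ∑ i ∈ Finset.range n, W t i x * W t n x) gm :=
      integrable_finsetSum _ fun i _ => WW_int t i n
    have hi3 : Integrable (fun x => (∑ i ∈ Finset.range n, W t i x) ^ 2
        + 2 * (∑ i ∈ Finset.range n, W t i x * W t n x)) gm := hi1.add (hi2.const_mul 2)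
    simp_rw [e]
    rw [integral_add hi3 (WW_int t n n),
      integral_add hi1 (hi2.const_mul 2), integral_const_mul,
      integral_finsetSum _ fun i _ => WW_int t i n]
    have h2 : ∑ i ∈ Finset.range n, ∫ x, W t i x * W t n x ∂gm ≤ 50 * (Lf t * mean t) := by
      have hb : ∀ i ∈ Finset.range n, ∫ x, W t i x * W t n x ∂gm ≤
          (49 / 50 : ℝ) ^ (n - 1 - i) * (Lf t * mean t) := by
        intro i hi
        rw [Finset.mem_range] at hi
        rw [W_cov]
        have h := E3 t i (n - 1 - i)
        rw [show i + (n - 1 - i) + 1 = n by omega] at h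
        linarith
      refine (Finset.sum_le_sum hb).trans ?_
      rw [← Finset.sum_mul]
      exact mul_le_mul_of_nonneg_right (geo_le n) (mul_nonneg (Lf_nonneg t) (mean_nonneg t))
    have h3 : ∫ x, W t n x * W t n x ∂gm ≤ 2 * t / Real.log 2 := by
      rw [W_cov]
      have := E2 t n
      have := mul_self_nonneg (mean t)
      linarith
    push_cast
    linarith

lemma sq_int (t n : ℕ) : Integrable (fun x => (∑ i ∈ Finset.range n, W t i x) ^ 2) gm := by
  simp_rw [pow_two, Finset.sum_mul_sum]
  exact integrable_finsetSum _ fun i _ => integrable_finsetSum _ fun j _ => WW_int t i j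

/-- event that two digits are large -/
def bad (s n : ℕ) : Set ℝ := {x | ∃ i j, i < j ∧ j < n ∧ s ≤ cfCoeff x i ∧ s ≤ cfCoeff x j}

lemma bad_bound (s n : ℕ) (hs : 1 ≤ s) :
    gm (bad s n) ≤ ENNReal.ofReal ((n:ℝ) ^ 2 * (2 / (Real.log 2 * (s:ℝ) ^ 2))) := by
  have hl : 0 < Real.log 2 := Real.log_pos (by norm_num)
  have hsub : bad s n ⊆ ⋃ i ∈ Finset.range n, ⋃ d ∈ Finset.range n,
      gaussMap^[i] ⁻¹' {x | s ≤ dig x ∧ s ≤ dig (gaussMap^[d + 1] x)} := by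
    rintro x ⟨i, j, hij, hj, h1, h2⟩
    simp only [Set.mem_iUnion, Finset.mem_range]
    refine ⟨i, by omega, j - i - 1, by omega, ?_⟩
    refine ⟨h1, ?_⟩
    rw [← Function.iterate_add_apply, show j - i - 1 + 1 + i = j by omega]
    exact h2
  have hpre : ∀ i d : ℕ, gm (gaussMap^[i] ⁻¹' {x | s ≤ dig x ∧ s ≤ dig (gaussMap^[d + 1] x)}) ≤
      ENNReal.ofReal (2 / (Real.log 2 * (s:ℝ) ^ 2)) := by
    intro i d
    have hm : MeasurableSet {x | s ≤ dig x ∧ s ≤ dig (gaussMap^[d + 1] x)} :=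
      (dig_set_meas s).inter ((iter_meas (d + 1)) (dig_set_meas s))
    have h := inv_iter (Set.indicator {x | s ≤ dig x ∧ s ≤ dig (gaussMap^[d + 1] x)} 1)
      (measurable_one.indicator hm) i
    rw [lintegral_indicator_one hm] at h
    have h' : ∫⁻ x, Set.indicator {x | s ≤ dig x ∧ s ≤ dig (gaussMap^[d + 1] x)}
        (1 : ℝ → ENNReal) (gaussMap^[i] x) ∂gm =
        gm (gaussMap^[i] ⁻¹' {x | s ≤ dig x ∧ s ≤ dig (gaussMap^[d + 1] x)}) := by
      rw [← lintegral_indicator_one (iter_meas i hm)]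
      rfl
    rw [← h', h]
    exact pair_bound s hs d
  calc gm (bad s n) ≤ _ := measure_mono hsub
    _ ≤ ∑ i ∈ Finset.range n, gm (⋃ d ∈ Finset.range n,
      gaussMap^[i] ⁻¹' {x | s ≤ dig x ∧ s ≤ dig (gaussMap^[d + 1] x)}) :=
        measure_biUnion_finset_le _ _
    _ ≤ ∑ i ∈ Finset.range n, ∑ d ∈ Finset.range n,
      gm (gaussMap^[i] ⁻¹' {x | s ≤ dig x ∧ s ≤ dig (gaussMap^[d + 1] x)}) :=
        Finset.sum_le_sum fun i _ => measure_biUnion_finset_le _ _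
    _ ≤ ∑ i ∈ Finset.range n, ∑ d ∈ Finset.range n,
      ENNReal.ofReal (2 / (Real.log 2 * (s:ℝ) ^ 2)) :=
        Finset.sum_le_sum fun i _ => Finset.sum_le_sum fun d _ => hpre i d
    _ = _ := by
        rw [Finset.sum_const, Finset.sum_const, Finset.card_range, nsmul_eq_mul, nsmul_eq_mul,
          ENNReal.ofReal_mul (by positivity), ENNReal.ofReal_pow (by positivity),
          ENNReal.ofReal_natCast]
        ring

end DV


namespace DV

open Topology

lemma interp (u g : ℕ → ℝ) (nk : ℕ → ℕ) (l : ℝ) (hu : Monotone u) (hu0 : ∀ n, 0 ≤ u n)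
    (hg : Monotone g) (hg0 : ∀ k, 0 < g (nk k)) (hnk : Monotone nk) (hinf : Tendsto nk atTop atTop)
    (h1 : Tendsto (fun k => u (nk k) / g (nk k)) atTop (𝓝 l))
    (h2 : Tendsto (fun k => g (nk (k + 1)) / g (nk k)) atTop (𝓝 1)) :
    Tendsto (fun n => u n / g n) atTop (𝓝 l) := by
  have hA : Tendsto (fun k => u (nk (k + 1)) / g (nk k)) atTop (𝓝 l) := by
    have := (h1.comp (tendsto_add_atTop_nat 1)).mul h2
    rw [mul_one] at this
    refine this.congr fun k => ?_
    have := (hg0 k).ne'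
    have := (hg0 (k + 1)).ne'
    simp only [Function.comp_apply]
    field_simp
  have hB : Tendsto (fun k => u (nk k) / g (nk (k + 1))) atTop (𝓝 l) := by
    have := h1.mul (h2.inv₀ one_ne_zero)
    rw [_root_.inv_one, mul_one] at this
    refine this.congr fun k => ?_
    have := (hg0 k).ne'
    have := (hg0 (k + 1)).ne'
    field_simp
  rw [Metric.tendsto_atTop] at hA hB ⊢
  intro ε hε
  obtain ⟨K1, hK1⟩ := hA ε hε
  obtain ⟨K2, hK2⟩ := hB ε hε
  refine ⟨nk (max K1 K2), fun n hn => ?_⟩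
  have hex : ∃ j, n < nk j := ((tendsto_atTop.mp hinf (n + 1)).exists).imp fun j hj => hj
  classical
  have hj := Nat.find_spec hex
  have hjK : max K1 K2 < Nat.find hex := by
    by_contra h
    push Not at h
    have := hnk h
    omega
  obtain ⟨k, hk⟩ : ∃ k, Nat.find hex = k + 1 := ⟨Nat.find hex - 1, by omega⟩
  have hk1 : nk k ≤ n := by
    have := Nat.find_min hex (m := k) (by omega)
    omega
  rw [hk] at hj hjK
  have a := hK1 k (by omega)
  have b := hK2 k (by omega)
  rw [Real.dist_eq, abs_lt] at a b ⊢
  have g1 := hg hk1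
  have g2 := hg hj.le
  have u1 := hu hk1
  have u2 := hu hj.le
  have gp : 0 < g n := (hg0 k).trans_le g1
  have c1 : u n / g n ≤ u (nk (k + 1)) / g (nk k) :=
    div_le_div₀ (hu0 _) u2 (hg0 k) g1
  have c2 : u (nk k) / g (nk (k + 1)) ≤ u n / g n :=
    div_le_div₀ (hu0 _) u1 gp g2
  constructor <;> linarith [a.1, a.2, b.1, b.2]

lemma det_trim (a : ℕ → ℕ) (n t : ℕ) (h : ∀ i j, i < j → j < n → ¬ (t + 1 ≤ a i ∧ t + 1 ≤ a j)) :
    |((∑ i ∈ Finset.range n, (a i : ℝ)) - (((Finset.range n).sup a : ℕ) : ℝ))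
      - ∑ i ∈ Finset.range n, ((min (a i) t : ℕ) : ℝ)| ≤ t := by
  rcases Nat.eq_zero_or_pos n with h0 | h0
  · subst h0; simp
  · obtain ⟨i0, hi0, hs⟩ := Finset.exists_mem_eq_sup (Finset.range n)
      ⟨0, Finset.mem_range.mpr h0⟩ a
    have hle : ∀ i ∈ Finset.range n, a i ≤ a i0 := fun i hi => by
      rw [← hs]; exact Finset.le_sup hi
    rw [hs, ← Finset.add_sum_erase _ _ hi0, ← Finset.add_sum_erase _ (fun i => ((min (a i) t : ℕ) : ℝ)) hi0]
    have e : ∑ i ∈ (Finset.range n).erase i0, ((min (a i) t : ℕ) : ℝ) =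
        ∑ i ∈ (Finset.range n).erase i0, (a i : ℝ) := by
      refine Finset.sum_congr rfl fun i hi => ?_
      rw [Finset.mem_erase] at hi
      have h1 := hle i hi.2
      have h2 := Finset.mem_range.mp hi.2
      have h3 := Finset.mem_range.mp hi0
      congr 1
      rw [min_eq_left]
      by_contra hc
      push Not at hc
      rcases lt_or_gt_of_ne hi.1 with h4 | h4
      · exact h i i0 h4 h3 ⟨by omega, by omega⟩
      · exact h i0 i h4 h2 ⟨by omega, by omega⟩
    rw [e]
    have h5 : ((min (a i0) t : ℕ) : ℝ) ≤ t := by exact_mod_cast min_le_right _ _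
    have h6 : (0:ℝ) ≤ ((min (a i0) t : ℕ) : ℝ) := Nat.cast_nonneg _
    rw [abs_le]
    constructor <;> linarith

lemma ae_tendsto_zero (f : ℕ → ℝ → ℝ) (c : ℕ → ℝ)
    (hi : ∀ k, Integrable (fun x => (f k x) ^ 2) gm)
    (hm : ∀ k, Measurable (f k))
    (hc : Summable c) (h : ∀ k, ∫ x, (f k x) ^ 2 ∂gm ≤ c k) :
    ∀ᵐ x ∂gm, Tendsto (fun k => f k x) atTop (𝓝 0) := by
  have hc0 : ∀ k, 0 ≤ c k := fun k => (integral_nonneg fun x => sq_nonneg (f k x)).trans (h k)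
  have hm2 : ∀ k, Measurable (fun x => ENNReal.ofReal ((f k x) ^ 2)) := fun k =>
    ENNReal.measurable_ofReal.comp ((hm k).pow_const 2)
  have h1 : ∫⁻ x, ∑' k, ENNReal.ofReal ((f k x) ^ 2) ∂gm ≠ ⊤ := by
    rw [lintegral_tsum fun k => (hm2 k).aemeasurable]
    have : ∀ k, ∫⁻ x, ENNReal.ofReal ((f k x) ^ 2) ∂gm ≤ ENNReal.ofReal (c k) := by
      intro k
      rw [← ofReal_integral_eq_lintegral_ofReal (hi k) (Eventually.of_forall fun x => sq_nonneg _)]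
      exact ENNReal.ofReal_le_ofReal (h k)
    refine ne_top_of_le_ne_top ?_ (ENNReal.tsum_le_tsum this)
    rw [← ENNReal.ofReal_tsum_of_nonneg hc0 hc]
    exact ENNReal.ofReal_ne_top
  have h2 := ae_lt_top (Measurable.tsum hm2) h1
  filter_upwards [h2] with x hx
  have h3 := ENNReal.tendsto_atTop_zero_of_tsum_ne_top hx.ne
  have h4 := (ENNReal.tendsto_toReal ENNReal.zero_ne_top).comp h3
  have h5 : Tendsto (fun k => (f k x) ^ 2) atTop (𝓝 0) := by
    refine h4.congr fun k => ?_
    simp only [Function.comp_apply]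
    rw [ENNReal.toReal_ofReal (sq_nonneg _)]
  have h6 := h5.sqrt
  simp only [Real.sqrt_sq_eq_abs, Real.sqrt_zero] at h6
  exact (tendsto_zero_iff_abs_tendsto_zero _).mpr h6

/-- truncation level -/
noncomputable def tt (n : ℕ) : ℕ := ⌊(n:ℝ) * (Real.log n) ^ (2 / 3 : ℝ)⌋₊

lemma logn_nonneg (n : ℕ) : 0 ≤ Real.log (n:ℝ) := Real.log_natCast_nonneg n

lemma log_mono {n m : ℕ} (h : n ≤ m) : Real.log (n:ℝ) ≤ Real.log (m:ℝ) := by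
  rcases Nat.eq_zero_or_pos n with h0 | h0
  · subst h0; simp [logn_nonneg]
  · exact Real.log_le_log (by exact_mod_cast h0) (by exact_mod_cast h)

lemma tt_mono : Monotone tt := by
  intro n m h
  unfold tt
  refine Nat.floor_mono ?_
  have := logn_nonneg n
  have := log_mono h
  gcongr

lemma tt_le (n : ℕ) : (tt n : ℝ) ≤ (n:ℝ) * (Real.log n) ^ (2 / 3 : ℝ) := by
  have := logn_nonneg n
  exact Nat.floor_le (by positivity)

lemma tt_lt (n : ℕ) : (n:ℝ) * (Real.log n) ^ (2 / 3 : ℝ) < tt n + 1 := Nat.lt_floor_add_one _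

lemma log_sq_le (t : ℕ) : (Real.log ((t:ℝ) + 1)) ^ 2 ≤ 4 * t := by
  have ht : (0:ℝ) ≤ t := Nat.cast_nonneg t
  have h0 : 0 ≤ Real.log ((t:ℝ) + 1) := Real.log_nonneg (by linarith)
  have h1 : 0 < Real.sqrt ((t:ℝ) + 1) := Real.sqrt_pos.mpr (by linarith)
  have h2 := Real.log_le_sub_one_of_pos h1
  rw [Real.log_sqrt (by linarith)] at h2
  have h3 : Real.sqrt ((t:ℝ) + 1) ≤ Real.sqrt t + 1 := by
    rw [Real.sqrt_le_left (by positivity)]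
    nlinarith [Real.sq_sqrt ht, Real.sqrt_nonneg (t:ℝ)]
  have h4 : Real.log ((t:ℝ) + 1) ≤ 2 * Real.sqrt t := by linarith
  calc _ ≤ (2 * Real.sqrt t) ^ 2 := by gcongr
    _ = _ := by rw [mul_pow, Real.sq_sqrt ht]; norm_num

lemma Lf_le (t : ℕ) : Lf t ≤ 2 * Real.log ((t:ℝ) + 1) := by
  have hl : 0 < Real.log 2 := Real.log_pos (by norm_num)
  have h := log_sum t
  rw [← Finset.sum_div, div_left_inj' hl.ne'] at h
  rw [← h, Finset.mul_sum]
  unfold Lf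
  refine Finset.sum_le_sum fun m _ => ?_
  have hx : 0 ≤ 1 / ((m:ℝ) + 1) := by positivity
  have hx1 : 1 / ((m:ℝ) + 1) ≤ 1 := by
    rw [div_le_one (by positivity)]; linarith [(Nat.cast_nonneg m : (0:ℝ) ≤ m)]
  have h1 := Real.le_log_one_add_of_nonneg hx
  refine le_trans ?_ (mul_le_mul_of_nonneg_left h1 (by norm_num))
  rw [← mul_div_assoc, le_div_iff₀ (by positivity)]
  nlinarith

lemma var_simple (t n : ℕ) : ∫ x, (∑ i ∈ Finset.range n, W t i x) ^ 2 ∂gm ≤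
    802 / Real.log 2 * (n * t) := by
  have hl : 0 < Real.log 2 := Real.log_pos (by norm_num)
  refine (variance_bound t n).trans ?_
  have h1 : Lf t * mean t ≤ 8 * t / Real.log 2 := by
    unfold mean
    rw [← mul_div_assoc]
    refine div_le_div_of_nonneg_right ?_ hl.le
    have ht : (0:ℝ) ≤ t := Nat.cast_nonneg t
    have h0 : 0 ≤ Real.log ((t:ℝ) + 1) := Real.log_nonneg (by linarith)
    nlinarith [mul_le_mul_of_nonneg_right (Lf_le t) h0, log_sq_le t]
  calc _ ≤ (n:ℝ) * (2 * t / Real.log 2 + 100 * (8 * t / Real.log 2)) := by gcongr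
    _ = _ := by field_simp; ring

end DV


namespace DV

open Topology

/-- exponents of the subsequence -/
noncomputable def sk (k : ℕ) : ℝ := ((k:ℝ) + 1) ^ (4 / 5 : ℝ)

/-- the subsequence -/
noncomputable def nk (k : ℕ) : ℕ := ⌈Real.exp (sk k)⌉₊

lemma sk_ge_one (k : ℕ) : 1 ≤ sk k := by
  unfold sk
  refine Real.one_le_rpow ?_ (by norm_num)
  linarith [(Nat.cast_nonneg k : (0:ℝ) ≤ k)]

lemma sk_mono : Monotone sk := by
  intro a b h
  unfold sk
  have : (a:ℝ) ≤ b := by exact_mod_cast h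
  gcongr

lemma nk_mono : Monotone nk := by
  intro a b h
  exact Nat.ceil_mono (Real.exp_le_exp.mpr (sk_mono h))

lemma nk_ge (k : ℕ) : Real.exp (sk k) ≤ nk k := Nat.le_ceil _

lemma nk_le (k : ℕ) : (nk k : ℝ) ≤ Real.exp (sk k) + 1 := (Nat.ceil_lt_add_one (by positivity)).le

lemma nk_pos (k : ℕ) : (0:ℝ) < nk k := (Real.exp_pos _).trans_le (nk_ge k)

lemma log_nk (k : ℕ) : sk k ≤ Real.log (nk k) := by
  rw [Real.le_log_iff_exp_le (nk_pos k)]; exact nk_ge k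

lemma sk_tendsto : Tendsto sk atTop atTop := by
  unfold sk
  exact (tendsto_rpow_atTop (by norm_num)).comp
    (tendsto_atTop_add_const_right _ _ tendsto_natCast_atTop_atTop)

lemma nk_tendsto : Tendsto nk atTop atTop := by
  have : Tendsto (fun k => (nk k : ℝ)) atTop atTop :=
    tendsto_atTop_mono nk_ge (Real.tendsto_exp_atTop.comp sk_tendsto)
  exact tendsto_natCast_atTop_iff.mp this

lemma sk_diff (k : ℕ) : sk (k + 1) - sk k ≤ ((k:ℝ) + 1) ^ (-(1 / 5) : ℝ) := by
  unfold sk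
  have hk : (0:ℝ) < (k:ℝ) + 1 := by positivity
  have e : ((k + 1 : ℕ) : ℝ) + 1 = ((k:ℝ) + 1) * (1 + 1 / ((k:ℝ) + 1)) := by
    push_cast; field_simp
  rw [e, Real.mul_rpow hk.le (by positivity)]
  have h1 : (1 + 1 / ((k:ℝ) + 1)) ^ (4 / 5 : ℝ) ≤ 1 + 4 / 5 * (1 / ((k:ℝ) + 1)) := by
    refine _root_.rpow_one_add_le_one_add_mul_self ?_ (by norm_num) (by norm_num)
    have : 0 ≤ 1 / ((k:ℝ) + 1) := by positivity
    linarith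
  have h2 : ((k:ℝ) + 1) ^ (-(1 / 5) : ℝ) = ((k:ℝ) + 1) ^ (4 / 5 : ℝ) * (1 / ((k:ℝ) + 1)) := by
    rw [show (-(1 / 5) : ℝ) = 4 / 5 - 1 by norm_num, Real.rpow_sub hk, Real.rpow_one]
    ring
  rw [h2]
  have h3 : 0 ≤ ((k:ℝ) + 1) ^ (4 / 5 : ℝ) := by positivity
  have h4 : 0 ≤ ((k:ℝ) + 1) ^ (4 / 5 : ℝ) * (1 / ((k:ℝ) + 1)) := by positivity
  nlinarith [mul_le_mul_of_nonneg_left h1 h3]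

lemma nk_ratio_le (k : ℕ) : (nk (k + 1) : ℝ) / nk k ≤
    Real.exp (((k:ℝ) + 1) ^ (-(1 / 5) : ℝ)) + Real.exp (-sk k) := by
  have h1 : (nk (k + 1) : ℝ) / nk k ≤ (Real.exp (sk (k + 1)) + 1) / Real.exp (sk k) :=
    div_le_div₀ (by positivity) (nk_le _) (Real.exp_pos _) (nk_ge k)
  refine h1.trans ?_
  rw [add_div, ← Real.exp_sub, one_div, ← Real.exp_neg]
  gcongr
  exact sk_diff k

lemma nk_ratio_le4 (k : ℕ) : (nk (k + 1) : ℝ) ≤ 4 * nk k := by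
  have h := nk_ratio_le k
  have h1 : ((k:ℝ) + 1) ^ (-(1 / 5) : ℝ) ≤ 1 :=
    Real.rpow_le_one_of_one_le_of_nonpos (by linarith [(Nat.cast_nonneg k : (0:ℝ) ≤ k)])
      (by norm_num)
  have h2 : Real.exp (((k:ℝ) + 1) ^ (-(1 / 5) : ℝ)) ≤ Real.exp 1 := Real.exp_le_exp.mpr h1
  have h3 : Real.exp (-sk k) ≤ 1 := by
    rw [Real.exp_le_one_iff]; linarith [sk_ge_one k]
  have h4 := Real.exp_one_lt_d9
  rw [← div_le_iff₀ (nk_pos k)]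
  linarith

lemma nk_ratio : Tendsto (fun k => (nk (k + 1) : ℝ) / nk k) atTop (𝓝 1) := by
  have h1 : Tendsto (fun k : ℕ => Real.exp (((k:ℝ) + 1) ^ (-(1 / 5) : ℝ)) + Real.exp (-sk k)) atTop
      (𝓝 (Real.exp 0 + 0)) := by
    refine Tendsto.add ?_ ?_
    · refine (Real.continuous_exp.tendsto 0).comp ?_
      exact (tendsto_rpow_neg_atTop (by norm_num)).comp
        (tendsto_atTop_add_const_right _ _ tendsto_natCast_atTop_atTop)
    · exact Real.tendsto_exp_neg_atTop_nhds_zero.comp sk_tendsto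
  rw [Real.exp_zero, add_zero] at h1
  refine tendsto_of_tendsto_of_tendsto_of_le_of_le tendsto_const_nhds h1 ?_ nk_ratio_le
  intro k
  simp only
  rw [le_div_iff₀ (nk_pos k), one_mul]
  exact_mod_cast nk_mono (Nat.le_succ k)

lemma log_nk_pos (k : ℕ) : 0 < Real.log (nk k) :=
  lt_of_lt_of_le one_pos ((sk_ge_one k).trans (log_nk k))

lemma log_nk_tendsto : Tendsto (fun k => Real.log (nk k)) atTop atTop :=
  tendsto_atTop_mono log_nk sk_tendsto

lemma log_nk_ratio : Tendsto (fun k => Real.log (nk (k + 1)) / Real.log (nk k)) atTop (𝓝 1) := by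
  have h1 : Tendsto (fun k => 1 + Real.log ((nk (k + 1) : ℝ) / nk k) / Real.log (nk k)) atTop
      (𝓝 (1 + 0)) := by
    refine tendsto_const_nhds.add ?_
    refine Tendsto.div_atTop (a := Real.log 1) ?_ log_nk_tendsto
    · exact (Real.continuousAt_log one_ne_zero).tendsto.comp nk_ratio
  rw [add_zero] at h1
  refine h1.congr fun k => ?_
  rw [Real.log_div (nk_pos _).ne' (nk_pos _).ne']
  have := (log_nk_pos k).ne'
  field_simp
  ring

/-- normalization -/
noncomputable def gg (n : ℕ) : ℝ := (n:ℝ) * Real.log n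

lemma gg_mono : Monotone gg := by
  intro a b h
  unfold gg
  have := log_mono h
  have := logn_nonneg a
  gcongr

lemma gg_pos (k : ℕ) : 0 < gg (nk k) := mul_pos (nk_pos k) (log_nk_pos k)

lemma gg_ratio : Tendsto (fun k => gg (nk (k + 1)) / gg (nk k)) atTop (𝓝 1) := by
  have := nk_ratio.mul log_nk_ratio
  rw [one_mul] at this
  refine this.congr fun k => ?_
  unfold gg
  rw [div_mul_div_comm]

/-- summable majorant -/
noncomputable def ek (k : ℕ) : ℝ := ((k:ℝ) + 1) ^ (-(16 / 15) : ℝ)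

lemma ek_summable : Summable ek := by
  have h : Summable (fun n : ℕ => (n:ℝ) ^ (-(16 / 15) : ℝ)) :=
    Real.summable_nat_rpow.mpr (by norm_num)
  have h2 := (summable_nat_add_iff 1).mpr h
  unfold ek
  simpa using h2

lemma log_rpow_le (k : ℕ) : (Real.log (nk k)) ^ (-(4 / 3) : ℝ) ≤ ek k := by
  have h1 : (Real.log (nk k)) ^ (-(4 / 3) : ℝ) ≤ (sk k) ^ (-(4 / 3) : ℝ) :=
    Real.rpow_le_rpow_of_nonpos (lt_of_lt_of_le one_pos (sk_ge_one k)) (log_nk k) (by norm_num)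
  refine h1.trans (le_of_eq ?_)
  unfold sk ek
  rw [← Real.rpow_mul (by positivity)]
  norm_num

lemma rpow_id1 {l : ℝ} (hl : 0 < l) : l ^ (2 / 3 : ℝ) / l ^ 2 = l ^ (-(4 / 3) : ℝ) := by
  rw [← Real.rpow_natCast, ← Real.rpow_sub hl]; norm_num

lemma rpow_id2 {l : ℝ} (hl : 0 < l) : 1 / (l ^ (2 / 3 : ℝ)) ^ 2 = l ^ (-(4 / 3) : ℝ) := by
  rw [← Real.rpow_natCast, ← Real.rpow_mul hl.le, one_div, ← Real.rpow_neg hl.le]; norm_num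

/-- Almost everywhere convergence along the subsequence. -/
lemma ae_A : ∀ᵐ x ∂gm, Tendsto
    (fun k => (∑ i ∈ Finset.range (nk k), W (tt (nk k)) i x) / gg (nk k)) atTop (𝓝 0) := by
  have hl2 : 0 < Real.log 2 := Real.log_pos (by norm_num)
  refine ae_tendsto_zero _ (fun k => 802 / Real.log 2 * ek k) ?_ ?_ (ek_summable.mul_left _) ?_
  · intro k
    simp_rw [div_pow]
    exact (sq_int _ _).div_const _
  · intro k
    exact (Finset.measurable_fun_sum _ fun i _ => W_meas _ i).div_const _
  · intro k
    simp_rw [div_pow]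
    rw [integral_div]
    have hn := nk_pos k
    have hl := log_nk_pos k
    have h1 := var_simple (tt (nk k)) (nk k)
    have h2 := tt_le (nk k)
    calc _ ≤ 802 / Real.log 2 * (nk k * (nk k * (Real.log (nk k)) ^ (2 / 3 : ℝ))) / gg (nk k) ^ 2 := by
          gcongr
          exact h1.trans (by gcongr)
      _ = 802 / Real.log 2 * ((Real.log (nk k)) ^ (2 / 3 : ℝ) / (Real.log (nk k)) ^ 2) := by
          unfold gg
          field_simp
      _ ≤ _ := by
          rw [rpow_id1 hl]
          gcongr
          exact log_rpow_le k

lemma ae_B : ∀ᵐ x ∂gm, ∀ᶠ k in atTop, x ∉ bad (tt (nk k) + 1) (nk (k + 1)) := by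
  have hl2 : 0 < Real.log 2 := Real.log_pos (by norm_num)
  refine ae_eventually_notMem ?_
  have h : ∀ k, gm (bad (tt (nk k) + 1) (nk (k + 1))) ≤
      ENNReal.ofReal (32 / Real.log 2 * ek k) := by
    intro k
    refine (bad_bound _ _ (by omega)).trans (ENNReal.ofReal_le_ofReal ?_)
    have hn := nk_pos k
    have hl := log_nk_pos k
    have h1 := (tt_lt (nk k)).le
    have h2 := nk_ratio_le4 k
    push_cast
    calc _ ≤ (4 * (nk k : ℝ)) ^ 2 *
          (2 / (Real.log 2 * ((nk k) * (Real.log (nk k)) ^ (2 / 3 : ℝ)) ^ 2)) := by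
          gcongr
      _ = 32 / Real.log 2 * (1 / ((Real.log (nk k)) ^ (2 / 3 : ℝ)) ^ 2) := by
          field_simp
          norm_num
      _ ≤ _ := by
          rw [rpow_id2 hl]
          gcongr
          exact log_rpow_le k
  refine ne_top_of_le_ne_top ?_ (ENNReal.tsum_le_tsum h)
  rw [← ENNReal.ofReal_tsum_of_nonneg _ (ek_summable.mul_left _)]
  · exact ENNReal.ofReal_ne_top
  · intro k
    unfold ek
    positivity

lemma log_tendsto : Tendsto (fun n : ℕ => Real.log (n:ℝ)) atTop atTop :=
  Real.tendsto_log_atTop.comp tendsto_natCast_atTop_atTop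

lemma log_ge_one : ∀ᶠ n : ℕ in atTop, 1 ≤ Real.log (n:ℝ) := log_tendsto.eventually_ge_atTop 1

lemma mean_ratio : Tendsto (fun n : ℕ => mean (tt n) / Real.log n) atTop (𝓝 (1 / Real.log 2)) := by
  have hl2 : 0 < Real.log 2 := Real.log_pos (by norm_num)
  have h : Tendsto (fun n : ℕ => Real.log ((tt n : ℝ) + 1) / Real.log n) atTop (𝓝 1) := by
    have hU : Tendsto (fun n : ℕ => Real.log 2 / Real.log n + 1
        + Real.log (Real.log n) / Real.log n) atTop (𝓝 (0 + 1 + 0)) := by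
      refine Tendsto.add (Tendsto.add ?_ tendsto_const_nhds) ?_
      · exact Tendsto.div_atTop tendsto_const_nhds log_tendsto
      · exact (Real.isLittleO_log_id_atTop.tendsto_div_nhds_zero).comp log_tendsto
    rw [zero_add, add_zero] at hU
    refine tendsto_of_tendsto_of_tendsto_of_le_of_le' tendsto_const_nhds hU ?_ ?_
    · filter_upwards [log_ge_one, eventually_ge_atTop 1] with n hn hn1
      have hn1' : (1:ℝ) ≤ n := by exact_mod_cast hn1
      rw [le_div_iff₀ (by linarith), one_mul]
      refine Real.log_le_log (by linarith) ?_
      have h1 := (tt_lt n).le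
      have h2 : 1 ≤ (Real.log (n:ℝ)) ^ (2 / 3 : ℝ) := Real.one_le_rpow hn (by norm_num)
      nlinarith
    · filter_upwards [log_ge_one, eventually_ge_atTop 1] with n hn hn1
      have hn1' : (1:ℝ) ≤ n := by exact_mod_cast hn1
      have hlp : 0 < Real.log (n:ℝ) := by linarith
      have e : Real.log 2 / Real.log n + 1 + Real.log (Real.log n) / Real.log n =
          Real.log (2 * n * Real.log n) / Real.log n := by
        rw [Real.log_mul (by positivity) hlp.ne', Real.log_mul (by norm_num) (by positivity)]
        field_simp
      rw [e]
      refine div_le_div_of_nonneg_right ?_ hlp.le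
      refine Real.log_le_log (by positivity) ?_
      have h1 := tt_le n
      have h2 : (Real.log (n:ℝ)) ^ (2 / 3 : ℝ) ≤ Real.log n := by
        conv_rhs => rw [← Real.rpow_one (Real.log n)]
        exact Real.rpow_le_rpow_of_exponent_le hn (by norm_num)
      nlinarith
  have := h.div_const (Real.log 2)
  refine this.congr fun n => ?_
  unfold mean
  rw [div_right_comm]

lemma tt_ratio : Tendsto (fun n : ℕ => (tt n : ℝ) / gg n) atTop (𝓝 0) := by
  have h1 : Tendsto (fun n : ℕ => (Real.log (n:ℝ)) ^ (-(1 / 3) : ℝ)) atTop (𝓝 0) :=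
    (tendsto_rpow_neg_atTop (by norm_num)).comp log_tendsto
  refine tendsto_of_tendsto_of_tendsto_of_le_of_le' tendsto_const_nhds h1 ?_ ?_
  · refine Eventually.of_forall fun n => ?_
    have := logn_nonneg n
    unfold gg
    positivity
  · filter_upwards [log_ge_one, eventually_ge_atTop 1] with n hn hn1
    have hn1' : (1:ℝ) ≤ n := by exact_mod_cast hn1
    have hlp : 0 < Real.log (n:ℝ) := by linarith
    unfold gg
    rw [div_le_iff₀ (by positivity)]
    refine (tt_le n).trans (le_of_eq ?_)
    rw [show (2 / 3 : ℝ) = -(1 / 3) + 1 by norm_num, Real.rpow_add hlp, Real.rpow_one]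
    ring

/-- truncated sums -/
noncomputable def U (x : ℝ) (n : ℕ) : ℝ := ∑ i ∈ Finset.range n, Y (tt n) i x

lemma U_mono (x : ℝ) : Monotone (U x) := by
  intro a b h
  unfold U
  have hsub : Finset.range a ⊆ Finset.range b := Finset.range_subset_range.mpr h
  refine (Finset.sum_le_sum fun i _ => ?_).trans
    (Finset.sum_le_sum_of_subset_of_nonneg hsub fun i _ _ => Y_nonneg (tt b) i x)
  unfold Y
  exact_mod_cast min_le_min_left _ (tt_mono h)

lemma U_nonneg (x : ℝ) (n : ℕ) : 0 ≤ U x n := Finset.sum_nonneg fun i _ => Y_nonneg _ i x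

lemma main_ae : ∀ᵐ r ∂gm, Tendsto (fun n : ℕ =>
    ((∑ i ∈ Finset.range n, (cfCoeff r i : ℝ))
      - (((Finset.range n).sup (cfCoeff r) : ℕ) : ℝ)) / ((n : ℝ) * Real.log n))
    atTop (𝓝 (1 / Real.log 2)) := by
  filter_upwards [ae_A, ae_B] with x hA hB
  have hsub : Tendsto (fun k => U x (nk k) / gg (nk k)) atTop (𝓝 (1 / Real.log 2)) := by
    have h := hA.add (mean_ratio.comp nk_tendsto)
    rw [zero_add] at h
    refine h.congr fun k => ?_
    have hn := nk_pos k
    have hl := log_nk_pos k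
    unfold U W gg
    simp only [Function.comp_apply, Finset.sum_sub_distrib, Finset.sum_const, Finset.card_range,
      nsmul_eq_mul]
    field_simp
    ring
  have hU := interp (U x) gg nk _ (U_mono x) (U_nonneg x) gg_mono gg_pos nk_mono nk_tendsto
    hsub gg_ratio
  have hdiff : ∀ᶠ n : ℕ in atTop, |((∑ i ∈ Finset.range n, (cfCoeff x i : ℝ))
      - (((Finset.range n).sup (cfCoeff x) : ℕ) : ℝ)) - U x n| ≤ tt n := by
    obtain ⟨K, hK⟩ := eventually_atTop.mp hB
    filter_upwards [eventually_ge_atTop (nk K)] with n hn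
    have hex : ∃ j, n < nk j := ((tendsto_atTop.mp nk_tendsto (n + 1)).exists).imp fun j hj => hj
    classical
    have hj := Nat.find_spec hex
    have hjK : K < Nat.find hex := by
      by_contra h
      push Not at h
      have := nk_mono h
      omega
    obtain ⟨k, hk⟩ : ∃ k, Nat.find hex = k + 1 := ⟨Nat.find hex - 1, by omega⟩
    have hk1 : nk k ≤ n := by
      have := Nat.find_min hex (m := k) (by omega)
      omega
    rw [hk] at hj hjK
    have hbad := hK k (by omega)
    have ht := tt_mono hk1
    refine det_trim (cfCoeff x) n (tt n) ?_
    intro i j hij hjn ⟨h1, h2⟩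
    exact hbad ⟨i, j, hij, by omega, by omega, by omega⟩
  have hz : Tendsto (fun n => (((∑ i ∈ Finset.range n, (cfCoeff x i : ℝ))
      - (((Finset.range n).sup (cfCoeff x) : ℕ) : ℝ)) - U x n) / gg n) atTop (𝓝 0) := by
    refine squeeze_zero_norm' ?_ tt_ratio
    filter_upwards [hdiff] with n hn
    have hg : 0 ≤ gg n := mul_nonneg (Nat.cast_nonneg n) (logn_nonneg n)
    rw [Real.norm_eq_abs, abs_div, abs_of_nonneg hg]
    gcongr
  have := hz.add hU
  rw [zero_add] at this
  refine this.congr fun n => ?_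
  rw [← add_div, sub_add_cancel]
  rfl

end DV


/-- Diamond–Vaaler: the trimmed sum of continued fraction coefficients satisfies
`(∑_{i≤n} a_i − max_{i≤n} a_i)/(n log n) → 1/log 2` almost everywhere. -/
theorem stmt_7 :
    ∀ᵐ r ∂(volume.restrict (Set.Icc (0:ℝ) 1)),
      Tendsto
        (fun n : ℕ =>
          ((∑ i ∈ Finset.range n, (cfCoeff r i : ℝ))
              - (((Finset.range n).sup (cfCoeff r) : ℕ) : ℝ))
            / ((n : ℝ) * Real.log n))
        atTop (nhds (1 / Real.log 2)) := by
  exact DV.gm_ac.ae_le DV.main_ae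
end

section
/- For Lebesgue-almost every irrational r ∈ [0,1], if p_n/q_n denotes the n-th convergent of the continued fraction expansion of r, then lim_{n→∞} (log q_n)/n = π²/(12 log 2). -/
open MeasureTheory Real Filter

/-- `qDen r n` is the denominator `q_n` of the `n`-th convergent of `r`. -/
noncomputable def qDen (r : ℝ) : ℕ → ℕ
  | 0 => 1
  | 1 => cfCoeff r 0
  | (n + 2) => cfCoeff r (n + 1) * qDen r (n + 1) + qDen r n

noncomputable def birkMax (T : ℝ → ℝ) (f : ℝ → ℝ) : ℕ → ℝ → ℝ
  | 0 => f
  | n + 1 => fun x => f x + max 0 (birkMax T f n (T x))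

lemma birkMax_succ (T f : ℝ → ℝ) (n : ℕ) (x : ℝ) :
    birkMax T f (n+1) x = f x + max 0 (birkMax T f n (T x)) := rfl

lemma birkMax_le_succ (T f : ℝ → ℝ) (n : ℕ) : ∀ x, birkMax T f n x ≤ birkMax T f (n+1) x := by
  induction n with
  | zero => intro x; rw [birkMax_succ]; simp [birkMax]
  | succ n ih =>
    intro x
    rw [birkMax_succ, birkMax_succ T f (n+1)]
    have := ih (T x)
    gcongr

lemma birkMax_mono (T f : ℝ → ℝ) (x : ℝ) : Monotone (fun n => birkMax T f n x) :=
  monotone_nat_of_le_succ (fun n => birkMax_le_succ T f n x)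

lemma birkhoffSum_le_birkMax (T f : ℝ → ℝ) (n : ℕ) :
    ∀ x, birkhoffSum T f (n+1) x ≤ birkMax T f n x := by
  induction n with
  | zero => intro x; simp [birkMax]
  | succ n ih =>
    intro x
    rw [birkMax_succ, birkhoffSum_succ']
    have := ih (T x)
    have h2 := le_max_right 0 (birkMax T f n (T x))
    linarith

lemma birkMax_measurable {T f : ℝ → ℝ} (hT : Measurable T) (hf : Measurable f) (n : ℕ) :
    Measurable (birkMax T f n) := by
  induction n with
  | zero => exact hf
  | succ n ih => exact hf.add (measurable_const.max (ih.comp hT))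

lemma birkMax_integrable {μ : Measure ℝ} {T f : ℝ → ℝ} (hT : MeasurePreserving T μ μ)
    (hf : Integrable f μ) [IsFiniteMeasure μ] (n : ℕ) :
    Integrable (birkMax T f n) μ := by
  induction n with
  | zero => exact hf
  | succ n ih =>
    have h1 : Integrable (fun x => birkMax T f n (T x)) μ :=
      hT.integrable_comp_of_integrable ih
    exact hf.add ((integrable_const (0:ℝ)).sup h1)

lemma birk_neg {μ : Measure ℝ} [IsProbabilityMeasure μ] {T f : ℝ → ℝ} (hT : Ergodic T μ)
    (hfm : Measurable f) (hf : Integrable f μ) (hneg : ∫ x, f x ∂μ < 0) :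
    ∀ᵐ x ∂μ, ∃ C, ∀ n, birkhoffSum T f (n+1) x ≤ C := by
  have hTm := hT.measurable
  have hmp : MeasurePreserving T μ μ := hT.toMeasurePreserving
  set A : Set ℝ := {x | ∀ C : ℕ, ∃ n, (C:ℝ) < birkMax T f n x} with hA
  have hAm : MeasurableSet A := by
    have : A = ⋂ C : ℕ, ⋃ n : ℕ, {x | (C:ℝ) < birkMax T f n x} := by ext x; simp [hA]
    rw [this]
    exact MeasurableSet.iInter fun C => MeasurableSet.iUnion fun n =>
      measurableSet_lt measurable_const (birkMax_measurable hTm hfm n)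
  have hAinv : T ⁻¹' A = A := by
    ext x
    simp only [hA, Set.mem_preimage, Set.mem_ofPred_eq]
    constructor
    · intro h C
      obtain ⟨N, hN⟩ := exists_nat_gt (C - f x)
      obtain ⟨n, hn⟩ := h N
      refine ⟨n+1, ?_⟩
      rw [birkMax_succ]
      have h2 := le_max_right 0 (birkMax T f n (T x))
      linarith
    · intro h C
      obtain ⟨N, hN⟩ := exists_nat_gt (C + |f x|)
      obtain ⟨n, hn⟩ := h N
      have h3 := birkMax_le_succ T f n x
      rw [birkMax_succ] at h3
      refine ⟨n, ?_⟩
      have h4 := le_abs_self (f x)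
      have h0 : (0:ℝ) ≤ C := Nat.cast_nonneg C
      by_contra hcon
      push Not at hcon
      have : max 0 (birkMax T f n (T x)) ≤ C := max_le h0 hcon
      linarith
  have key : 0 ≤ ∫ x in A, f x ∂μ := by
    have hlim : Tendsto (fun n => ∫ x in A, (f x + max 0 (-(birkMax T f n (T x)))) ∂μ) atTop
        (nhds (∫ x in A, f x ∂μ)) := by
      refine tendsto_integral_of_dominated_convergence (fun x => |f x| + |f (T x)|) ?_ ?_ ?_ ?_
      · intro n
        exact (hfm.add (measurable_const.max
          ((birkMax_measurable hTm hfm n).comp hTm).neg)).aestronglyMeasurable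
      · exact (hf.abs.add (hmp.integrable_comp_of_integrable hf).abs).integrableOn
      · intro n
        refine Eventually.of_forall fun x => ?_
        refine (norm_add_le _ _).trans ?_
        have h1 : f (T x) ≤ birkMax T f n (T x) := birkMax_mono T f (T x) (Nat.zero_le n)
        have h2 : ‖max 0 (-(birkMax T f n (T x)))‖ ≤ |f (T x)| := by
          rw [Real.norm_of_nonneg (le_max_left _ _)]
          refine max_le (abs_nonneg _) ?_
          have := neg_abs_le (f (T x))
          linarith
        rw [Real.norm_eq_abs]
        linarith
      · refine (ae_restrict_iff' hAm).2 (Eventually.of_forall fun x hx => ?_)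
        have hx' : T x ∈ A := by rw [← hAinv] at hx; exact hx
        obtain ⟨N, hN⟩ := hx' 0
        refine tendsto_const_nhds.congr' ?_
        filter_upwards [eventually_ge_atTop N] with n hn
        have h1 : birkMax T f N (T x) ≤ birkMax T f n (T x) := birkMax_mono T f (T x) hn
        simp only [Nat.cast_zero] at hN
        rw [max_eq_left (by linarith), add_zero]
    refine ge_of_tendsto' hlim fun n => ?_
    have e1 : ∫ x in A, (f x + max 0 (-(birkMax T f n (T x)))) ∂μ
        = ∫ x in A, birkMax T f (n+1) x ∂μ - ∫ x in A, birkMax T f n (T x) ∂μ := by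
      have hi : Integrable (fun x => birkMax T f n (T x)) μ :=
        hmp.integrable_comp_of_integrable (birkMax_integrable hmp hf n)
      rw [← integral_sub (birkMax_integrable hmp hf (n+1)).integrableOn hi.integrableOn]
      congr 1
      ext x
      rw [birkMax_succ]
      rcases le_total 0 (birkMax T f n (T x)) with h | h
      · rw [max_eq_right h, max_eq_left (by linarith)]; ring
      · rw [max_eq_left h, max_eq_right (by linarith)]; ring
    have e2 : ∫ x in A, birkMax T f n (T x) ∂μ = ∫ x in A, birkMax T f n x ∂μ := by
      have h := hmp.restrict_preimage hAm
      rw [hAinv] at h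
      nth_rewrite 2 [← h.map_eq]
      rw [integral_map h.measurable.aemeasurable
        (birkMax_measurable hTm hfm n).aestronglyMeasurable]
    rw [e1, e2, sub_nonneg]
    exact integral_mono (birkMax_integrable hmp hf n).integrableOn
      (birkMax_integrable hmp hf (n+1)).integrableOn (fun x => birkMax_le_succ T f n x)
  have hA0 : μ A = 0 := by
    rcases hT.toPreErgodic.ae_empty_or_univ hAm hAinv with h | h
    · exact (measure_congr h).trans measure_empty
    · rw [setIntegral_congr_set h, setIntegral_univ] at key
      linarith
  rw [← compl_mem_ae_iff] at hA0
  filter_upwards [hA0] with x hx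
  simp only [hA, Set.mem_compl_iff, Set.mem_ofPred_eq] at hx
  push Not at hx
  obtain ⟨C, hC⟩ := hx
  exact ⟨C, fun n => (birkhoffSum_le_birkMax T f n x).trans (hC n)⟩

lemma birk_upper {μ : Measure ℝ} [IsProbabilityMeasure μ] {T f : ℝ → ℝ} (hT : Ergodic T μ)
    (hfm : Measurable f) (hf : Integrable f μ) :
    ∀ᵐ x ∂μ, ∀ ε > 0, ∀ᶠ n : ℕ in atTop, birkhoffSum T f n x / n < ∫ x, f x ∂μ + ε := by
  have h : ∀ᵐ x ∂μ, ∀ m : ℕ, ∃ C, ∀ n, birkhoffSum T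
      (fun y => f y - (∫ x, f x ∂μ + 1 / ((m:ℝ)+1))) (n+1) x ≤ C := by
    rw [ae_all_iff]
    intro m
    refine birk_neg hT (hfm.sub_const _) (hf.sub (integrable_const _)) ?_
    rw [integral_sub hf (integrable_const _)]
    have : (0:ℝ) < 1 / ((m:ℝ)+1) := by positivity
    simp only [integral_const, probReal_univ, one_smul]
    linarith
  filter_upwards [h] with x hx ε hε
  obtain ⟨m, hm⟩ := exists_nat_one_div_lt (half_pos hε)
  obtain ⟨C, hC⟩ := hx m
  obtain ⟨N, hN⟩ := exists_nat_gt (C / (ε/2))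
  filter_upwards [eventually_ge_atTop (N+1)] with n hn
  obtain ⟨k, rfl⟩ : ∃ k, n = k + 1 := ⟨n-1, by omega⟩
  have h1 := hC k
  have hk : (0:ℝ) < ((k+1:ℕ):ℝ) := by positivity
  have e : birkhoffSum T (fun y => f y - (∫ x, f x ∂μ + 1 / ((m:ℝ)+1))) (k+1) x
      = birkhoffSum T f (k+1) x - ((k+1:ℕ):ℝ) * (∫ x, f x ∂μ + 1 / ((m:ℝ)+1)) := by
    simp [birkhoffSum, Finset.sum_sub_distrib]
    ring
  rw [e] at h1
  rw [div_lt_iff₀ hk]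
  rw [div_lt_iff₀ (half_pos hε)] at hN
  have hNk : (N:ℝ) ≤ ((k+1:ℕ):ℝ) := by exact_mod_cast (by omega)
  nlinarith

lemma birk_main {μ : Measure ℝ} [IsProbabilityMeasure μ] {T f : ℝ → ℝ} (hT : Ergodic T μ)
    (hfm : Measurable f) (hf : Integrable f μ) :
    ∀ᵐ x ∂μ, Tendsto (fun n : ℕ => birkhoffSum T f n x / n) atTop (nhds (∫ x, f x ∂μ)) := by
  filter_upwards [birk_upper hT hfm hf, birk_upper hT hfm.neg hf.neg] with x h1 h2
  rw [Metric.tendsto_nhds]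
  intro ε hε
  filter_upwards [h1 ε hε, h2 ε hε] with n a b
  have e : birkhoffSum T (-f) n x = - birkhoffSum T f n x := by
    simp [birkhoffSum, Finset.sum_neg_distrib]
  rw [e, neg_div] at b
  simp only [Pi.neg_apply, integral_neg] at b
  rw [Real.dist_eq, abs_lt]
  constructor <;> linarith

lemma int_pow_log (k : ℕ) :
    IntegrableOn (fun x : ℝ => x ^ k * (-log x)) (Set.Ioc 0 1) ∧
    ∫ x in Set.Ioc (0:ℝ) 1, x ^ k * (-log x) = 1 / ((k:ℝ)+1)^2 := by
  have hk : ((k:ℝ)+1) ≠ 0 := by positivity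
  set F : ℝ → ℝ := fun x => x ^ k * (-(x * log x)) / ((k:ℝ)+1) + x^(k+1) / ((k:ℝ)+1)^2 with hF
  have hc : Continuous F := by
    have := Real.continuous_mul_log
    fun_prop
  have hd : ∀ x ∈ Set.Ioo (0:ℝ) 1, HasDerivAt F (x ^ k * (-log x)) x := by
    intro x hx
    have hx0 : x ≠ 0 := hx.1.ne'
    have e : F = fun x => x ^ (k+1) * (-log x) / ((k:ℝ)+1) + x^(k+1) / ((k:ℝ)+1)^2 := by
      ext y; simp only [hF]; ring
    rw [e]
    have h1 := hasDerivAt_pow (k+1) x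
    have h2 := (Real.hasDerivAt_log hx0).neg
    convert! ((h1.mul h2).div_const ((k:ℝ)+1)).add (h1.div_const (((k:ℝ)+1)^2)) using 1
    simp only [Nat.add_sub_cancel, Nat.cast_add, Nat.cast_one, Pi.neg_apply]
    field_simp
    ring
  have hpos : ∀ x ∈ Set.Ioo (0:ℝ) 1, 0 ≤ x ^ k * (-log x) := by
    intro x hx
    have : log x ≤ 0 := Real.log_nonpos hx.1.le hx.2.le
    have : 0 ≤ -log x := by linarith
    have := hx.1.le
    positivity
  have hi : IntegrableOn (fun x : ℝ => x ^ k * (-log x)) (Set.Ioc 0 1) :=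
    intervalIntegral.integrableOn_deriv_of_nonneg hc.continuousOn hd hpos
  refine ⟨hi, ?_⟩
  rw [← intervalIntegral.integral_of_le zero_le_one,
    intervalIntegral.integral_eq_sub_of_hasDerivAt_of_le zero_le_one hc.continuousOn hd
      ((intervalIntegrable_iff_integrableOn_Ioc_of_le zero_le_one).2 hi)]
  simp [hF]

lemma alt_sum : HasSum (fun k : ℕ => (-1:ℝ)^k * (1 / ((k:ℝ)+1)^2)) (π^2/12) := by
  have h := hasSum_zeta_two
  have h1 : HasSum (fun n : ℕ => (1 : ℝ) / ((n : ℝ)+1) ^ 2) (π ^ 2 / 6) := by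
    have := (hasSum_nat_add_iff' 1).2 h
    simpa using this
  have hodd : HasSum (fun n : ℕ => (1 : ℝ) / (((2*n+1:ℕ) : ℝ)+1) ^ 2) (π ^ 2 / 24) := by
    have := h1.mul_left (1/4)
    convert! this using 1
    · ext n; push_cast; field_simp; ring
    · ring
  have hs : Summable (fun n : ℕ => (1 : ℝ) / (((2*n:ℕ) : ℝ)+1) ^ 2) :=
    h1.summable.comp_injective (i := fun n : ℕ => 2*n) (fun a b h => by simpa using h)
  have hev := hs.hasSum
  have := hev.even_add_odd (f := fun n : ℕ => (1 : ℝ) / ((n : ℝ)+1) ^ 2) hodd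
  have e := this.unique h1
  have e2 : ∑' n : ℕ, (1 : ℝ) / (((2*n:ℕ) : ℝ)+1) ^ 2 = π^2/8 := by linarith
  rw [e2] at hev
  have hfin : HasSum (fun k : ℕ => (-1:ℝ)^k * (1 / ((k:ℝ)+1)^2)) (π^2/8 + -(π^2/24)) := by
    apply HasSum.even_add_odd
    · convert! hev using 2 with n
      simp [pow_mul]
    · convert! hodd.neg using 2 with n
      simp [pow_mul, pow_succ]
  convert! hfin using 1
  ring

lemma int_log_div :
    IntegrableOn (fun x : ℝ => (-log x) / (1+x)) (Set.Ioc 0 1) ∧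
    ∫ x in Set.Ioc (0:ℝ) 1, (-log x) / (1+x) = π^2/12 := by
  constructor
  · have h := (int_pow_log 0).1
    refine Integrable.mono' h ?_ ?_
    · exact ((Real.measurable_log.neg).div (measurable_const.add measurable_id)).aestronglyMeasurable
    · refine (ae_restrict_iff' measurableSet_Ioc).2 (Eventually.of_forall fun x hx => ?_)
      have : log x ≤ 0 := Real.log_nonpos hx.1.le hx.2
      have h2 : 0 ≤ -log x := by linarith
      have h3 := hx.1
      rw [Real.norm_of_nonneg (by positivity)]
      simp only [pow_zero, one_mul]
      exact div_le_self h2 (by linarith)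
  · have hh := hasSum_integral_of_summable_integral_norm (μ := volume.restrict (Set.Ioc (0:ℝ) 1))
      (F := fun (k : ℕ) x => (-1:ℝ)^k * (x ^ k * (-log x)))
      (fun k => (int_pow_log k).1.const_mul _) ?_
    · have e : ∀ k : ℕ, ∫ x in Set.Ioc (0:ℝ) 1, (-1:ℝ)^k * (x ^ k * (-log x))
          = (-1:ℝ)^k * (1 / ((k:ℝ)+1)^2) := fun k => by
        rw [integral_const_mul, (int_pow_log k).2]
      simp only [e] at hh
      rw [← hh.unique alt_sum]
      rw [integral_Ioc_eq_integral_Ioo, integral_Ioc_eq_integral_Ioo]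
      refine setIntegral_congr_fun measurableSet_Ioo fun x hx => ?_
      have hx1 : |(-x)| < 1 := by rw [abs_neg, abs_of_pos hx.1]; exact hx.2
      have hg := (hasSum_geometric_of_abs_lt_one hx1).mul_right (-log x)
      have e3 : ∀ k : ℕ, (-1:ℝ)^k * (x ^ k * (-log x)) = (-x)^k * (-log x) := fun k => by
        rw [neg_pow x]; ring
      simp only [e3]
      rw [hg.tsum_eq]
      rw [sub_neg_eq_add]; field_simp
    · have h1 : Summable (fun n : ℕ => (1 : ℝ) / ((n : ℝ)+1) ^ 2) := by
        have := (summable_nat_add_iff 1).2 hasSum_zeta_two.summable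
        simpa using this
      refine h1.congr fun k => ?_
      rw [← (int_pow_log k).2]
      refine setIntegral_congr_fun measurableSet_Ioc fun x hx => ?_
      have : log x ≤ 0 := Real.log_nonpos hx.1.le hx.2
      have h2 : 0 ≤ -log x := by linarith
      have h3 := hx.1
      simp only [norm_mul, norm_pow, norm_neg, norm_one, one_pow, one_mul]
      rw [Real.norm_of_nonneg h3.le, ← norm_neg, Real.norm_of_nonneg h2]


noncomputable def gBr (k : ℕ) (y : ℝ) : ℝ := ((k:ℝ) + 1 + y)⁻¹
noncomputable def gW (k : ℕ) (x : ℝ) : ℝ := (1 + x) / (((k:ℝ) + 1 + x) * ((k:ℝ) + 2 + x))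
noncomputable def gU (k : ℕ) (x : ℝ) : ℝ := (1 + x) / ((k:ℝ) + 1 + x)
noncomputable def gP (g : ℝ → ℝ) (x : ℝ) : ℝ := ∑' k : ℕ, gW k x * g (gBr k x)

structure GoodL (g : ℝ → ℝ) (L : ℝ) : Prop where
  hL : 0 ≤ L
  nonneg : ∀ x ∈ Set.Icc (0:ℝ) 1, 0 ≤ g x
  lip : ∀ x ∈ Set.Icc (0:ℝ) 1, ∀ y ∈ Set.Icc (0:ℝ) 1, |g x - g y| ≤ L * |x - y|

lemma gBr_mem (k : ℕ) {y : ℝ} (hy : 0 ≤ y) : gBr k y ∈ Set.Icc (0:ℝ) 1 := by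
  unfold gBr
  have hk : (0:ℝ) ≤ k := Nat.cast_nonneg k
  exact ⟨by positivity, inv_le_one_of_one_le₀ (by linarith)⟩

lemma gW_nonneg (k : ℕ) {x : ℝ} (hx : 0 ≤ x) : 0 ≤ gW k x := by unfold gW; positivity

lemma gW_eq (k : ℕ) {x : ℝ} (hx : 0 ≤ x) : gW k x = gU k x - gU (k+1) x := by
  unfold gW gU
  have h1 : ((k:ℝ) + 1 + x) ≠ 0 := by positivity
  have h2 : ((k:ℝ) + 2 + x) ≠ 0 := by positivity
  have h3 : (((k+1:ℕ):ℝ) + 1 + x) = (k:ℝ) + 2 + x := by push_cast; ring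
  rw [h3]
  field_simp
  ring

lemma gU_tendsto (x : ℝ) : Tendsto (fun k => gU k x) atTop (nhds 0) := by
  unfold gU
  apply Tendsto.div_atTop tendsto_const_nhds
  exact tendsto_atTop_add_const_right _ _ (tendsto_atTop_add_const_right _ _
    tendsto_natCast_atTop_atTop)

lemma gW_hasSum {x : ℝ} (hx : 0 ≤ x) : HasSum (fun k => gW k x) 1 := by
  rw [hasSum_iff_tendsto_nat_of_nonneg (fun k => gW_nonneg k hx)]
  have e : ∀ n, ∑ i ∈ Finset.range n, gW i x = gU 0 x - gU n x := by
    intro n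
    rw [← Finset.sum_range_sub' (fun k => gU k x)]
    exact Finset.sum_congr rfl fun k _ => gW_eq k hx
  simp only [e]
  have h0 : gU 0 x = 1 := by
    unfold gU
    have : (1 + x) ≠ 0 := by positivity
    simp [this]
  rw [h0]
  simpa using (tendsto_const_nhds (x := (1:ℝ))).sub (gU_tendsto x)

lemma GoodL.bound {g : ℝ → ℝ} {L : ℝ} (h : GoodL g L) {x : ℝ} (hx : x ∈ Set.Icc (0:ℝ) 1) :
    g x ≤ g 0 + L := by
  have h1 := h.lip x hx 0 (by simp)
  have h2 := le_abs_self (g x - g 0)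
  have h3 : |x - 0| ≤ 1 := by rw [sub_zero, abs_of_nonneg hx.1]; exact hx.2
  have := mul_le_mul_of_nonneg_left h3 h.hL
  linarith

lemma GoodL.summable {g : ℝ → ℝ} {L : ℝ} (h : GoodL g L) {x : ℝ} (hx : 0 ≤ x) :
    Summable (fun k : ℕ => gW k x * g (gBr k x)) := by
  refine Summable.of_nonneg_of_le (fun k => mul_nonneg (gW_nonneg k hx)
    (h.nonneg _ (gBr_mem k hx))) (fun k => ?_) ((gW_hasSum hx).summable.mul_right (g 0 + L))
  exact mul_le_mul_of_nonneg_left (h.bound (gBr_mem k hx)) (gW_nonneg k hx)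

lemma est_num (k : ℕ) {x y : ℝ} (hx : x ∈ Set.Icc (0:ℝ) 1) (hy : y ∈ Set.Icc (0:ℝ) 1) :
    gW k x * (1 / (((k:ℝ)+1+x) * ((k:ℝ)+1+y)))
      + (((k:ℝ)+1) / (((k:ℝ)+2+x) * ((k:ℝ)+2+y))) * (1 / (((k:ℝ)+1+y) * ((k:ℝ)+2+y)))
    ≤ (15/4) * (1 / (((k:ℝ)+1)*((k:ℝ)+2)*((k:ℝ)+3))) := by
  obtain ⟨hx0, hx1⟩ := hx
  obtain ⟨hy0, hy1⟩ := hy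
  have hk : (0:ℝ) ≤ k := Nat.cast_nonneg k
  have a1 : gW k x * (1 / (((k:ℝ)+1+x) * ((k:ℝ)+1+y)))
      ≤ 2 / (((k:ℝ)+1)^2 * ((k:ℝ)+2)^2) := by
    have b1 : (1 + x) / ((k:ℝ)+1+x) ≤ 2 / ((k:ℝ)+2) := by
      rw [div_le_div_iff₀ (by positivity) (by positivity)]
      nlinarith
    have b2 : 1 / (((k:ℝ)+2+x) * ((k:ℝ)+1+x) * ((k:ℝ)+1+y))
        ≤ 1 / (((k:ℝ)+2) * ((k:ℝ)+1) * ((k:ℝ)+1)) := by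
      gcongr 1 / (?_ * ?_ * ?_) <;> linarith
    calc gW k x * (1 / (((k:ℝ)+1+x) * ((k:ℝ)+1+y)))
        = (1 + x) / ((k:ℝ)+1+x) * (1 / (((k:ℝ)+2+x) * ((k:ℝ)+1+x) * ((k:ℝ)+1+y))) := by
          unfold gW; field_simp
      _ ≤ 2 / ((k:ℝ)+2) * (1 / (((k:ℝ)+2) * ((k:ℝ)+1) * ((k:ℝ)+1))) := by
          gcongr
      _ = 2 / (((k:ℝ)+1)^2 * ((k:ℝ)+2)^2) := by field_simp
  have a2 : (((k:ℝ)+1) / (((k:ℝ)+2+x) * ((k:ℝ)+2+y))) * (1 / (((k:ℝ)+1+y) * ((k:ℝ)+2+y)))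
      ≤ 1 / ((k:ℝ)+2)^3 := by
    calc (((k:ℝ)+1) / (((k:ℝ)+2+x) * ((k:ℝ)+2+y))) * (1 / (((k:ℝ)+1+y) * ((k:ℝ)+2+y)))
      ≤ (((k:ℝ)+1) / (((k:ℝ)+2) * ((k:ℝ)+2))) * (1 / (((k:ℝ)+1) * ((k:ℝ)+2))) := by
          gcongr (_ / (?_ * ?_)) * (1 / (?_ * ?_)) <;> linarith
      _ = 1 / ((k:ℝ)+2)^3 := by field_simp
  have a3 : 2 / (((k:ℝ)+1)^2 * ((k:ℝ)+2)^2) + 1 / ((k:ℝ)+2)^3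
      ≤ (15/4) * (1 / (((k:ℝ)+1)*((k:ℝ)+2)*((k:ℝ)+3))) := by
    rw [div_add_div _ _ (by positivity) (by positivity), mul_one_div,
      div_le_div_iff₀ (by positivity) (by positivity)]
    have : 0 ≤ (k:ℝ)^2 := by positivity
    rw [← sub_nonneg]
    ring_nf
    positivity
  linarith

lemma GoodL.partialBound {g : ℝ → ℝ} {L : ℝ} (h : GoodL g L) {x y : ℝ} (hx : x ∈ Set.Icc (0:ℝ) 1)
    (hy : y ∈ Set.Icc (0:ℝ) 1) (N : ℕ) :
    |∑ k ∈ Finset.range N, (gW k x * g (gBr k x) - gW k y * g (gBr k y))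
      + (gU N x - gU N y) * g (gBr N y)|
      ≤ L * |x - y| * ((15/4) * (1/4 - 1 / (2 * ((N:ℝ)+1) * ((N:ℝ)+2)))) := by
  have hx0 := hx.1
  have hy0 := hy.1
  induction N with
  | zero =>
    have h0 : ∀ z : ℝ, 0 ≤ z → gU 0 z = 1 := by
      intro z hz
      unfold gU
      have : (1 + z) ≠ 0 := by positivity
      simp [this]
    rw [h0 x hx.1, h0 y hy.1]
    norm_num
  | succ k ih =>
    have hk : (0:ℝ) ≤ k := Nat.cast_nonneg k
    set S := ∑ k ∈ Finset.range k, (gW k x * g (gBr k x) - gW k y * g (gBr k y))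
      + (gU k x - gU k y) * g (gBr k y) with hS
    have e : ∑ k ∈ Finset.range (k+1), (gW k x * g (gBr k x) - gW k y * g (gBr k y))
      + (gU (k+1) x - gU (k+1) y) * g (gBr (k+1) y) =
      S + (gW k x * (g (gBr k x) - g (gBr k y))
        + (gU (k+1) x - gU (k+1) y) * (g (gBr (k+1) y) - g (gBr k y))) := by
      rw [Finset.sum_range_succ, hS, gW_eq k hx.1, gW_eq k hy.1]
      ring
    rw [e]
    have d1 : |g (gBr k x) - g (gBr k y)| ≤ L * |x - y| * (1 / (((k:ℝ)+1+x) * ((k:ℝ)+1+y))) := by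
      refine (h.lip _ (gBr_mem k hx.1) _ (gBr_mem k hy.1)).trans (le_of_eq ?_)
      have : gBr k x - gBr k y = (y - x) * (1 / (((k:ℝ)+1+x) * ((k:ℝ)+1+y))) := by
        unfold gBr; field_simp; ring
      rw [this, abs_mul, abs_sub_comm y x, abs_of_nonneg (a := 1 / _) (by positivity)]
      ring
    have d2 : |g (gBr (k+1) y) - g (gBr k y)| ≤ L * (1 / (((k:ℝ)+1+y) * ((k:ℝ)+2+y))) := by
      refine (h.lip _ (gBr_mem (k+1) hy.1) _ (gBr_mem k hy.1)).trans (le_of_eq ?_)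
      have : gBr (k+1) y - gBr k y = - (1 / (((k:ℝ)+1+y) * ((k:ℝ)+2+y))) := by
        unfold gBr
        have h3 : (((k+1:ℕ):ℝ) + 1 + y) = (k:ℝ) + 2 + y := by push_cast; ring
        rw [h3]
        field_simp; ring
      rw [this, abs_neg, abs_of_nonneg (a := 1 / _) (by positivity)]
    have d3 : |gU (k+1) x - gU (k+1) y| = |x - y| * (((k:ℝ)+1) / (((k:ℝ)+2+x) * ((k:ℝ)+2+y))) := by
      have : gU (k+1) x - gU (k+1) y = (x - y) * (((k:ℝ)+1) / (((k:ℝ)+2+x) * ((k:ℝ)+2+y))) := by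
        unfold gU
        have h3 : ∀ z : ℝ, (((k+1:ℕ):ℝ) + 1 + z) = (k:ℝ) + 2 + z := by intro z; push_cast; ring
        rw [h3, h3]
        field_simp; ring
      rw [this, abs_mul, abs_of_nonneg (a := _ / _) (by positivity)]
    have hw := gW_nonneg k hx.1
    have t1 : |gW k x * (g (gBr k x) - g (gBr k y))| ≤
        gW k x * (L * |x - y| * (1 / (((k:ℝ)+1+x) * ((k:ℝ)+1+y)))) := by
      rw [abs_mul, abs_of_nonneg hw]
      gcongr
    have t2 : |(gU (k+1) x - gU (k+1) y) * (g (gBr (k+1) y) - g (gBr k y))| ≤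
        |x - y| * (((k:ℝ)+1) / (((k:ℝ)+2+x) * ((k:ℝ)+2+y))) *
          (L * (1 / (((k:ℝ)+1+y) * ((k:ℝ)+2+y)))) := by
      rw [abs_mul, d3]
      gcongr
    have t3 := mul_le_mul_of_nonneg_left (est_num k hx hy) (mul_nonneg h.hL (abs_nonneg (x - y)))
    have t4 : L * |x - y| * ((15/4) * (1/4 - 1 / (2 * (((k+1:ℕ):ℝ)+1) * (((k+1:ℕ):ℝ)+2)))) =
        L * |x - y| * ((15/4) * (1/4 - 1 / (2 * ((k:ℝ)+1) * ((k:ℝ)+2))))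
        + L * |x - y| * ((15/4) * (1 / (((k:ℝ)+1)*((k:ℝ)+2)*((k:ℝ)+3)))) := by
      rw [← mul_add, ← mul_add]
      congr 2
      push_cast
      have q1 : (k:ℝ)+1+1 = (k:ℝ)+2 := by ring
      have q2 : (k:ℝ)+1+2 = (k:ℝ)+3 := by ring
      rw [q1, q2]
      field_simp
      ring
    rw [t4]
    refine (abs_add_le _ _).trans (add_le_add ih ?_)
    refine (abs_add_le _ _).trans ((add_le_add t1 t2).trans (le_trans (le_of_eq ?_) t3))
    ring

lemma GoodL.gP {g : ℝ → ℝ} {L : ℝ} (h : GoodL g L) : GoodL (gP g) (15/16 * L) := by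
  refine ⟨by have := h.hL; positivity, ?_, ?_⟩
  · intro x hx
    exact tsum_nonneg fun k => mul_nonneg (gW_nonneg k hx.1) (h.nonneg _ (gBr_mem k hx.1))
  · intro x hx y hy
    have hs := (h.summable hx.1).hasSum.sub (h.summable hy.1).hasSum
    have ht := hs.tendsto_sum_nat
    have hu : Tendsto (fun N => (gU N x - gU N y) * g (gBr N y)) atTop (nhds 0) := by
      have h1 : Tendsto (fun N => |gU N x - gU N y| * (g 0 + L)) atTop (nhds 0) := by
        have := (((gU_tendsto x).sub (gU_tendsto y)).abs).mul_const (g 0 + L)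
        simpa using this
      refine squeeze_zero_norm (fun N => ?_) h1
      rw [Real.norm_eq_abs, abs_mul, abs_of_nonneg (h.nonneg _ (gBr_mem N hy.1))]
      exact mul_le_mul_of_nonneg_left (h.bound (gBr_mem N hy.1)) (abs_nonneg _)
    have hlim := (ht.add hu).abs
    rw [add_zero] at hlim
    refine le_of_tendsto' hlim fun N => ?_
    refine (h.partialBound hx hy N).trans ?_
    have h2 : (15/4) * (1/4 - 1 / (2 * ((N:ℝ)+1) * ((N:ℝ)+2))) ≤ 15/16 := by
      have : 0 ≤ 1 / (2 * ((N:ℝ)+1) * ((N:ℝ)+2)) := by positivity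
      linarith
    have := mul_le_mul_of_nonneg_left h2 (mul_nonneg h.hL (abs_nonneg (x - y)))
    linarith

lemma GoodL.iter {g : ℝ → ℝ} {L : ℝ} (h : GoodL g L) (n : ℕ) :
    GoodL (_root_.gP^[n] g) ((15/16)^n * L) := by
  induction n with
  | zero => simpa using h
  | succ n ih =>
    rw [Function.iterate_succ_apply']
    have := ih.gP
    rwa [← mul_assoc, ← pow_succ'] at this

/-! change of variables -/

lemma gBr_hasDeriv (k : ℕ) {y : ℝ} (hy : 0 ≤ y) : HasDerivAt (gBr k) (-(gBr k y)^2) y := by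
  have h : ((k:ℝ)+1+y) ≠ 0 := by positivity
  have := ((hasDerivAt_id y).const_add ((k:ℝ)+1)).inv h
  unfold gBr
  convert! this using 1
  simp only [id]
  field_simp

lemma gBr_floor (k : ℕ) {y : ℝ} (hy : y ∈ Set.Ico (0:ℝ) 1) : ⌊(gBr k y)⁻¹⌋ = k + 1 := by
  unfold gBr
  rw [inv_inv, Int.floor_eq_iff]
  push_cast
  constructor <;> linarith [hy.1, hy.2]

lemma gauss_gBr (k : ℕ) {y : ℝ} (hy : y ∈ Set.Ico (0:ℝ) 1) : gaussMap (gBr k y) = y := by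
  unfold gaussMap
  rw [← Int.self_sub_floor, gBr_floor k hy]
  unfold gBr
  rw [inv_inv]; push_cast; ring

lemma gBr_iUnion : (⋃ k : ℕ, gBr k '' Set.Ico (0:ℝ) 1) = Set.Ioc (0:ℝ) 1 := by
  ext x
  simp only [Set.mem_iUnion, Set.mem_image]
  constructor
  · rintro ⟨k, y, hy, rfl⟩
    refine ⟨?_, (gBr_mem k hy.1).2⟩
    have := hy.1
    unfold gBr; positivity
  · intro hx
    have h1 : 1 ≤ x⁻¹ := (one_le_inv₀ hx.1).2 hx.2
    have h2 : 1 ≤ ⌊x⁻¹⌋ := Int.le_floor.2 (by simpa using h1)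
    obtain ⟨k, hk⟩ : ∃ k : ℕ, ⌊x⁻¹⌋ = k + 1 := ⟨(⌊x⁻¹⌋ - 1).toNat, by omega⟩
    refine ⟨k, Int.fract x⁻¹, ⟨Int.fract_nonneg _, Int.fract_lt_one _⟩, ?_⟩
    unfold gBr
    rw [← Int.self_sub_floor, hk]
    push_cast
    rw [add_sub_cancel, inv_inv]

lemma gBr_inj (k : ℕ) : Set.InjOn (gBr k) (Set.Ico (0:ℝ) 1) := by
  intro a ha b hb h
  rw [← gauss_gBr k ha, h, gauss_gBr k hb]

lemma gBr_image_meas (k : ℕ) : MeasurableSet (gBr k '' Set.Ico (0:ℝ) 1) := by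
  refine measurableSet_Ico.image_of_continuousOn_injOn (fun y hy => ?_) (gBr_inj k)
  exact (gBr_hasDeriv k hy.1).continuousAt.continuousWithinAt

lemma gauss_cov (F : ℝ → ENNReal) :
    ∫⁻ x in Set.Ioo (0:ℝ) 1, F x =
      ∑' k : ℕ, ∫⁻ y in Set.Ioo (0:ℝ) 1, ENNReal.ofReal ((gBr k y)^2) * F (gBr k y) := by
  have e0 : ∫⁻ x in Set.Ioo (0:ℝ) 1, F x = ∫⁻ x in ⋃ k : ℕ, gBr k '' Set.Ico (0:ℝ) 1, F x := by
    rw [Measure.restrict_congr_set (Ioo_ae_eq_Ioc (μ := volume) (a := (0:ℝ)) (b := 1)),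
      ← gBr_iUnion]
  rw [e0, lintegral_iUnion gBr_image_meas]
  · congr 1
    ext k
    rw [lintegral_image_eq_lintegral_abs_deriv_mul measurableSet_Ico
      (fun y hy => (gBr_hasDeriv k hy.1).hasDerivWithinAt) (gBr_inj k)]
    rw [Measure.restrict_congr_set (Ioo_ae_eq_Ico (μ := volume) (a := (0:ℝ)) (b := 1))]
    simp only [abs_neg, abs_pow, sq_abs]
  · intro i j hij
    rw [Function.onFun, Set.disjoint_left]
    rintro x ⟨a, ha, rfl⟩ ⟨b, hb, h⟩
    have h1 := gBr_floor i ha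
    have h2 := gBr_floor j hb
    rw [h, h1] at h2
    omega

lemma gaussMap_measurable : Measurable gaussMap := measurable_fract.comp measurable_inv

noncomputable def gDens (x : ℝ) : ℝ := ((1 + x) * Real.log 2)⁻¹

lemma gDens_meas : Measurable (fun x => ENNReal.ofReal (gDens x)) := by
  unfold gDens; fun_prop

noncomputable def gaussM : Measure ℝ :=
  (volume.restrict (Set.Ioo (0:ℝ) 1)).withDensity (fun x => ENNReal.ofReal (gDens x))

lemma gDens_pos {x : ℝ} (hx : 0 ≤ x) : 0 < gDens x := by
  have := Real.log_pos one_lt_two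
  unfold gDens; positivity

lemma lintegral_gaussM (F : ℝ → ENNReal) :
    ∫⁻ x, F x ∂gaussM = ∫⁻ x in Set.Ioo (0:ℝ) 1, ENNReal.ofReal (gDens x) * F x := by
  unfold gaussM
  rw [lintegral_withDensity_eq_lintegral_mul_non_measurable _ gDens_meas
    (Eventually.of_forall fun x => ENNReal.ofReal_lt_top)]
  rfl

lemma GoodL.contOn {g : ℝ → ℝ} {L : ℝ} (h : GoodL g L) : ContinuousOn g (Set.Icc 0 1) := by
  have : LipschitzOnWith (Real.toNNReal L) g (Set.Icc 0 1) := by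
    refine LipschitzOnWith.of_dist_le_mul fun x hx y hy => ?_
    rw [Real.coe_toNNReal _ h.hL]
    exact h.lip x hx y hy
  exact this.continuousOn

lemma dens_id (k : ℕ) {y : ℝ} (hy : 0 ≤ y) : (gBr k y)^2 * gDens (gBr k y) = gDens y * gW k y := by
  unfold gBr gDens gW
  have := Real.log_pos one_lt_two
  field_simp
  ring

lemma gauss_dual {g : ℝ → ℝ} {L : ℝ} (h : GoodL g L) {G : ℝ → ENNReal} (hG : Measurable G) :
    ∫⁻ x, ENNReal.ofReal (g x) * G (gaussMap x) ∂gaussM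
      = ∫⁻ x, ENNReal.ofReal (gP g x) * G x ∂gaussM := by
  rw [lintegral_gaussM, lintegral_gaussM, gauss_cov]
  have e : ∀ k : ℕ, ∫⁻ y in Set.Ioo (0:ℝ) 1, ENNReal.ofReal ((gBr k y)^2) *
      (ENNReal.ofReal (gDens (gBr k y)) * (ENNReal.ofReal (g (gBr k y)) * G (gaussMap (gBr k y))))
      = ∫⁻ y in Set.Ioo (0:ℝ) 1, ENNReal.ofReal (gDens y) *
        (ENNReal.ofReal (gW k y * g (gBr k y)) * G y) := by
    intro k
    refine setLIntegral_congr_fun measurableSet_Ioo fun y hy => ?_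
    rw [gauss_gBr k ⟨hy.1.le, hy.2⟩, ← mul_assoc, ← mul_assoc, ← mul_assoc,
      ← ENNReal.ofReal_mul (by positivity), dens_id k hy.1.le,
      ENNReal.ofReal_mul (gDens_pos hy.1.le).le, ENNReal.ofReal_mul (gW_nonneg k hy.1.le), mul_assoc (ENNReal.ofReal (gDens y))]
  simp only [e]
  rw [← lintegral_tsum]
  · refine setLIntegral_congr_fun measurableSet_Ioo fun y hy => ?_
    rw [ENNReal.tsum_mul_left, ENNReal.tsum_mul_right]
    congr 2
    rw [gP, ENNReal.ofReal_tsum_of_nonneg]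
    · exact fun k => mul_nonneg (gW_nonneg k hy.1.le) (h.nonneg _ (gBr_mem k hy.1.le))
    · exact h.summable hy.1.le
  · intro k
    refine gDens_meas.aemeasurable.mul (AEMeasurable.mul ?_ hG.aemeasurable)
    refine AEMeasurable.ennreal_ofReal (AEMeasurable.mul ?_ ?_)
    · unfold gW; fun_prop
    · refine ContinuousOn.aemeasurable ?_ measurableSet_Ioo
      refine h.contOn.comp (fun y hy => ?_) (fun y hy => gBr_mem k hy.1.le)
      exact (gBr_hasDeriv k hy.1.le).continuousAt.continuousWithinAt

instance gaussM_prob : IsProbabilityMeasure gaussM := by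
  constructor
  have h0 := lintegral_gaussM (fun _ => 1)
  simp only [lintegral_const, one_mul, mul_one] at h0
  rw [h0, Measure.restrict_congr_set (Ioo_ae_eq_Ioc (μ := volume) (a := (0:ℝ)) (b := 1))]
  have hc : ContinuousOn gDens (Set.Icc 0 1) := by
    intro x hx
    have : (1 + x) * Real.log 2 ≠ 0 := by
      have := Real.log_pos one_lt_two
      have := hx.1
      positivity
    unfold gDens
    exact ContinuousAt.continuousWithinAt (by fun_prop (disch := assumption))
  have hi : IntegrableOn gDens (Set.Ioc 0 1) :=
    (hc.integrableOn_Icc).mono_set Set.Ioc_subset_Icc_self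
  rw [← ofReal_integral_eq_lintegral_ofReal hi]
  · rw [← intervalIntegral.integral_of_le zero_le_one]
    have : ∫ x in (0:ℝ)..1, gDens x = 1 := by
      have e : gDens = fun x => (Real.log 2)⁻¹ * (1 + x)⁻¹ := by
        ext x; unfold gDens; rw [mul_inv]; ring
      rw [e, intervalIntegral.integral_const_mul,
        intervalIntegral.integral_comp_add_left (fun x => x⁻¹) 1,
        integral_inv_of_pos (by norm_num) (by norm_num)]
      have := Real.log_pos one_lt_two
      norm_num
    rw [this]; simp
  · refine (ae_restrict_iff' measurableSet_Ioc).2 (Eventually.of_forall fun x hx => ?_)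
    exact (gDens_pos hx.1.le).le

lemma gaussM_ae_mem : ∀ᵐ x ∂gaussM, x ∈ Set.Ioo (0:ℝ) 1 := by
  have : gaussM ≪ volume.restrict (Set.Ioo (0:ℝ) 1) := withDensity_absolutelyContinuous _ _
  exact this.ae_le (ae_restrict_mem measurableSet_Ioo)

lemma gauss_mp : MeasurePreserving gaussMap gaussM gaussM := by
  refine ⟨gaussMap_measurable, ?_⟩
  refine Measure.ext_of_lintegral _ fun G hG => ?_
  rw [lintegral_map hG gaussMap_measurable]
  have h : GoodL (fun _ => 1) 0 := ⟨le_rfl, fun _ _ => zero_le_one, fun _ _ _ _ => by simp⟩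
  have hd := gauss_dual h hG
  simp only [ENNReal.ofReal_one, one_mul] at hd
  rw [hd]
  refine lintegral_congr_ae ?_
  filter_upwards [gaussM_ae_mem] with x hx
  have : gP (fun _ => 1) x = 1 := by
    unfold gP
    simp only [mul_one]
    exact (gW_hasSum hx.1.le).tsum_eq
  rw [this]; simp

lemma gauss_inv_iter {A : Set ℝ} (hA : MeasurableSet A) (hinv : gaussMap ⁻¹' A = A) {g : ℝ → ℝ}
    {L : ℝ} (h : GoodL g L) (n : ℕ) :
    ∫⁻ x in A, ENNReal.ofReal (g x) ∂gaussM = ∫⁻ x in A, ENNReal.ofReal (gP^[n] g x) ∂gaussM := by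
  have key : ∀ f : ℝ → ℝ, ∫⁻ x in A, ENNReal.ofReal (f x) ∂gaussM
      = ∫⁻ x, ENNReal.ofReal (f x) * A.indicator 1 x ∂gaussM := by
    intro f
    rw [← lintegral_indicator hA]
    congr 1
    ext x
    by_cases hx : x ∈ A <;> simp [hx]
  induction n with
  | zero => rfl
  | succ n ih =>
    rw [ih, Function.iterate_succ_apply', key, key,
      ← gauss_dual (h.iter n) (measurable_one.indicator hA)]
    congr 1
    ext x
    have : x ∈ A ↔ gaussMap x ∈ A := by
      nth_rewrite 1 [← hinv]; rfl
    by_cases hx : x ∈ A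
    · simp [hx, this.1 hx]
    · simp [hx, mt this.2 hx]

lemma gauss_mix {A : Set ℝ} (hA : MeasurableSet A) (hinv : gaussMap ⁻¹' A = A) {g : ℝ → ℝ}
    {L : ℝ} (h : GoodL g L) :
    ∫⁻ x in A, ENNReal.ofReal (g x) ∂gaussM
      ≤ (∫⁻ x, ENNReal.ofReal (g x) ∂gaussM) * gaussM A := by
  have hb : ∀ n : ℕ, ∫⁻ x in A, ENNReal.ofReal (g x) ∂gaussM
      ≤ (∫⁻ x, ENNReal.ofReal (g x) ∂gaussM
          + ENNReal.ofReal (2 * ((15/16)^n * L))) * gaussM A := by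
    intro n
    have hn := h.iter n
    set f := gP^[n] g with hf
    set ε := (15/16 : ℝ)^n * L with hε
    have hε0 : 0 ≤ ε := hn.hL
    have hosc : ∀ x ∈ Set.Ioo (0:ℝ) 1, |f x - f 0| ≤ ε := by
      intro x hx
      have h1 := hn.lip x ⟨hx.1.le, hx.2.le⟩ 0 (by simp)
      have h3 : |x - 0| ≤ 1 := by rw [sub_zero, abs_of_pos hx.1]; exact hx.2.le
      have := mul_le_mul_of_nonneg_left h3 hn.hL
      linarith
    have h1 : ∫⁻ x in A, ENNReal.ofReal (g x) ∂gaussM ≤ ENNReal.ofReal (f 0 + ε) * gaussM A := by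
      rw [gauss_inv_iter hA hinv h n, ← setLIntegral_const]
      refine lintegral_mono_ae (ae_restrict_of_ae ?_)
      filter_upwards [gaussM_ae_mem] with x hx
      apply ENNReal.ofReal_le_ofReal
      have := (abs_le.1 (hosc x hx)).2
      linarith
    have h2 : ENNReal.ofReal (f 0 - ε) ≤ ∫⁻ x, ENNReal.ofReal (g x) ∂gaussM := by
      have e := gauss_inv_iter MeasurableSet.univ Set.preimage_univ h n
      rw [setLIntegral_univ, setLIntegral_univ] at e
      rw [e]
      have : ENNReal.ofReal (f 0 - ε) = ∫⁻ x, ENNReal.ofReal (f 0 - ε) ∂gaussM := by simp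
      rw [this]
      refine lintegral_mono_ae ?_
      filter_upwards [gaussM_ae_mem] with x hx
      apply ENNReal.ofReal_le_ofReal
      have := (abs_le.1 (hosc x hx)).1
      linarith
    refine h1.trans ?_
    gcongr
    calc ENNReal.ofReal (f 0 + ε) = ENNReal.ofReal ((f 0 - ε) + 2 * ε) := by congr 1; ring
      _ ≤ ENNReal.ofReal (f 0 - ε) + ENNReal.ofReal (2 * ε) := ENNReal.ofReal_add_le
      _ ≤ _ := by gcongr
  have hlim : Tendsto (fun n : ℕ => (∫⁻ x, ENNReal.ofReal (g x) ∂gaussM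
          + ENNReal.ofReal (2 * ((15/16)^n * L))) * gaussM A) atTop
      (nhds ((∫⁻ x, ENNReal.ofReal (g x) ∂gaussM + ENNReal.ofReal (2 * (0 * L))) * gaussM A)) := by
    refine ENNReal.Tendsto.mul_const (Tendsto.add tendsto_const_nhds ?_) (Or.inr (measure_ne_top _ _))
    refine ENNReal.tendsto_ofReal (Tendsto.const_mul _ (Tendsto.mul_const _ ?_))
    exact tendsto_pow_atTop_nhds_zero_of_lt_one (by norm_num) (by norm_num)
  simp only [zero_mul, mul_zero, ENNReal.ofReal_zero, add_zero] at hlim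
  exact ge_of_tendsto' hlim hb

lemma gauss_closed {A : Set ℝ} (hA : MeasurableSet A) (hinv : gaussMap ⁻¹' A = A) {F : Set ℝ}
    (hF : IsClosed F) (hFA : F ⊆ A) : gaussM F ≤ gaussM F * gaussM A := by
  have hδ : ∀ n : ℕ, (0:ℝ) < 1 / ((n:ℝ)+1) := fun n => by positivity
  have hδ0 : Tendsto (fun n : ℕ => 1 / ((n:ℝ)+1)) atTop (nhds 0) :=
    tendsto_one_div_add_atTop_nhds_zero_nat
  have h1 := tendsto_lintegral_thickenedIndicator_of_isClosed (gaussM.restrict A) hF hδ hδ0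
  have h2 := ENNReal.Tendsto.mul_const
    (tendsto_lintegral_thickenedIndicator_of_isClosed gaussM hF hδ hδ0)
    (Or.inr (measure_ne_top gaussM A))
  rw [Measure.restrict_apply hF.measurableSet, Set.inter_eq_left.2 hFA] at h1
  refine le_of_tendsto_of_tendsto' h1 h2 fun n => ?_
  have hg : GoodL (fun x => (thickenedIndicator (hδ n) F x : ℝ))
      (((1 / ((n:ℝ)+1)).toNNReal⁻¹ : NNReal) : ℝ) := by
    refine ⟨NNReal.coe_nonneg _, fun x _ => NNReal.coe_nonneg _, fun x _ y _ => ?_⟩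
    exact (lipschitzWith_thickenedIndicator (hδ n) F).dist_le_mul x y
  have := gauss_mix hA hinv hg
  simpa only [ENNReal.ofReal_coe_nnreal] using this

lemma gauss_ergodic : Ergodic gaussMap gaussM := by
  refine ⟨gauss_mp, ⟨fun A hA hinv => ?_⟩⟩
  rw [eventuallyConst_set']
  by_cases h0 : gaussM A = 0
  · left; exact ae_eq_empty.2 h0
  · right
    obtain ⟨F, hFA, hF, hlt⟩ := hA.exists_lt_isClosed_of_ne_top (measure_ne_top gaussM A)
      (pos_iff_ne_zero.2 h0)
    have h1 := gauss_closed hA hinv hF hFA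
    have h2 : 1 ≤ gaussM A := by
      by_contra hc
      push Not at hc
      have := ENNReal.mul_lt_mul_right hlt.ne' (measure_ne_top gaussM F) hc
      rw [mul_one] at this
      exact absurd h1 (not_le.2 this)
    rw [ae_eq_univ]
    exact (prob_compl_eq_zero_iff hA).2 (le_antisymm prob_le_one h2)

/-! final assembly -/

lemma gauss_irr {r : ℝ} (hr : Irrational r) (h : r ∈ Set.Ioo (0:ℝ) 1) :
    ∀ n, Irrational (gaussMap^[n] r) ∧ gaussMap^[n] r ∈ Set.Ioo (0:ℝ) 1 := by
  intro n
  induction n with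
  | zero => exact ⟨hr, h⟩
  | succ n ih =>
    rw [Function.iterate_succ_apply']
    have h1 : Irrational (gaussMap (gaussMap^[n] r)) := by
      unfold gaussMap
      rw [← Int.self_sub_floor]
      exact (irrational_inv_iff.2 ih.1).sub_intCast _
    refine ⟨h1, ?_, Int.fract_lt_one _⟩
    exact lt_of_le_of_ne (Int.fract_nonneg _) (fun h => h1.ne_zero h.symm)

lemma cfCoeff_eq {r : ℝ} (hr : Irrational r) (h : r ∈ Set.Ioo (0:ℝ) 1) (n : ℕ) :
    (cfCoeff r n : ℝ) = (gaussMap^[n] r)⁻¹ - gaussMap^[n+1] r := by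
  obtain ⟨-, h1⟩ := gauss_irr hr h n
  have h2 : 0 ≤ ⌊(gaussMap^[n] r)⁻¹⌋ := Int.floor_nonneg.2 (inv_nonneg.2 h1.1.le)
  rw [Function.iterate_succ_apply', cfCoeff]
  have : ((⌊(gaussMap^[n] r)⁻¹⌋.toNat : ℕ) : ℝ) = ((⌊(gaussMap^[n] r)⁻¹⌋ : ℤ) : ℝ) := by
    exact_mod_cast congrArg (Int.cast (R := ℝ)) (Int.toNat_of_nonneg h2)
  have e : gaussMap (gaussMap^[n] r) = Int.fract (gaussMap^[n] r)⁻¹ := rfl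
  rw [this, e, ← Int.self_sub_floor]
  ring

lemma qDen_prod {r : ℝ} (hr : Irrational r) (h : r ∈ Set.Ioo (0:ℝ) 1) (n : ℕ) :
    ((qDen r (n+1) : ℝ) + qDen r n * gaussMap^[n+1] r)
      * ∏ k ∈ Finset.range (n+1), gaussMap^[k] r = 1 := by
  induction n with
  | zero =>
    have h0 := cfCoeff_eq hr h 0
    have hne : gaussMap^[0] r ≠ 0 := (gauss_irr hr h 0).2.1.ne'
    simp only [qDen, Finset.prod_range_one, Nat.cast_one, one_mul, zero_add] at *
    rw [h0, sub_add_cancel, inv_mul_cancel₀ hne]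
  | succ n ih =>
    rw [Finset.prod_range_succ]
    have h0 := cfCoeff_eq hr h (n+1)
    have hne : gaussMap^[n+1] r ≠ 0 := (gauss_irr hr h (n+1)).2.1.ne'
    have e : (qDen r (n+1+1) : ℝ) = cfCoeff r (n+1) * qDen r (n+1) + qDen r n := by
      rw [qDen]; push_cast; ring
    rw [e, h0, ← ih]
    field_simp
    ring

lemma cfCoeff_pos {r : ℝ} (hr : Irrational r) (h : r ∈ Set.Ioo (0:ℝ) 1) (n : ℕ) :
    1 ≤ cfCoeff r n := by
  obtain ⟨-, h1⟩ := gauss_irr hr h n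
  have h3 : 1 ≤ (gaussMap^[n] r)⁻¹ := (one_le_inv₀ h1.1).2 h1.2.le
  have h2 : 1 ≤ ⌊(gaussMap^[n] r)⁻¹⌋ := Int.le_floor.2 (by simpa using h3)
  unfold cfCoeff
  omega

lemma qDen_pos_mono {r : ℝ} (hr : Irrational r) (h : r ∈ Set.Ioo (0:ℝ) 1) (n : ℕ) :
    1 ≤ qDen r n ∧ qDen r n ≤ qDen r (n+1) := by
  induction n with
  | zero => exact ⟨le_rfl, cfCoeff_pos hr h 0⟩
  | succ n ih =>
    refine ⟨ih.1.trans ih.2, ?_⟩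
    have e : qDen r (n+1+1) = cfCoeff r (n+1) * qDen r (n+1) + qDen r n := by rw [qDen]
    rw [e]
    have := Nat.mul_le_mul_right (qDen r (n+1)) (cfCoeff_pos hr h (n+1))
    omega

lemma qDen_log {r : ℝ} (hr : Irrational r) (h : r ∈ Set.Ioo (0:ℝ) 1) (n : ℕ) :
    |Real.log (qDen r (n+1)) - birkhoffSum gaussMap (fun x => -Real.log x) (n+1) r|
      ≤ Real.log 2 := by
  have hp := qDen_prod hr h n
  have hpos : ∀ k, 0 < gaussMap^[k] r := fun k => (gauss_irr hr h k).2.1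
  have hlt := (gauss_irr hr h (n+1)).2.2
  have hq1 : (1:ℝ) ≤ qDen r n := by exact_mod_cast (qDen_pos_mono hr h n).1
  have hq2 : (qDen r n : ℝ) ≤ qDen r (n+1) := by exact_mod_cast (qDen_pos_mono hr h n).2
  have hb : birkhoffSum gaussMap (fun x => -Real.log x) (n+1) r
      = Real.log ((qDen r (n+1) : ℝ) + qDen r n * gaussMap^[n+1] r) := by
    rw [eq_inv_of_mul_eq_one_left hp, Real.log_inv, Real.log_prod (fun k _ => (hpos k).ne'),
      birkhoffSum, Finset.sum_neg_distrib]
  rw [hb, abs_sub_comm]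
  have hm : 0 < (qDen r n : ℝ) * gaussMap^[n+1] r := mul_pos (by linarith) (hpos _)
  have hm2 : (qDen r n : ℝ) * gaussMap^[n+1] r ≤ qDen r (n+1) := by nlinarith [hpos (n+1)]
  have l1 : Real.log (qDen r (n+1)) ≤ Real.log ((qDen r (n+1) : ℝ) + qDen r n * gaussMap^[n+1] r) :=
    Real.log_le_log (by linarith) (by linarith)
  have l2 : Real.log ((qDen r (n+1) : ℝ) + qDen r n * gaussMap^[n+1] r)
      ≤ Real.log 2 + Real.log (qDen r (n+1)) := by
    rw [← Real.log_mul (by norm_num) (by linarith)]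
    exact Real.log_le_log (by linarith) (by linarith)
  rw [abs_of_nonneg (by linarith)]
  linarith

lemma gauss_int : Integrable (fun x => -Real.log x) gaussM ∧
    ∫ x, -Real.log x ∂gaussM = π^2 / (12 * Real.log 2) := by
  have hl := Real.log_pos one_lt_two
  have hfun : ∀ x ∈ Set.Ioc (0:ℝ) 1, (ENNReal.ofReal (gDens x)).toReal • (-Real.log x)
      = (Real.log 2)⁻¹ * (-Real.log x / (1 + x)) := by
    intro x hx
    rw [ENNReal.toReal_ofReal (gDens_pos hx.1.le).le, smul_eq_mul, gDens, mul_inv]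
    ring
  constructor
  · unfold gaussM
    rw [integrable_withDensity_iff_integrable_smul' gDens_meas
      (Eventually.of_forall fun x => ENNReal.ofReal_lt_top)]
    have h := (int_log_div.1.const_mul (Real.log 2)⁻¹)
    have h2 := (integrableOn_congr_fun hfun measurableSet_Ioc).2 h
    exact h2.mono_set Set.Ioo_subset_Ioc_self
  · unfold gaussM
    rw [integral_withDensity_eq_integral_toReal_smul gDens_meas
      (Eventually.of_forall fun x => ENNReal.ofReal_lt_top), ← integral_Ioc_eq_integral_Ioo,
      setIntegral_congr_fun measurableSet_Ioc hfun, integral_const_mul, int_log_div.2]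
    field_simp

/-- Lévy's constant: `log q_n / n → π²/(12 log 2)` for Lebesgue-a.e. `r ∈ [0,1]`. -/
theorem stmt_8 :
    ∀ᵐ r ∂(volume.restrict (Set.Icc (0:ℝ) 1)), Irrational r →
      Tendsto (fun n : ℕ => Real.log (qDen r n) / (n : ℝ))
        atTop (nhds (π ^ 2 / (12 * Real.log 2))) := by
  have hlog := birk_main gauss_ergodic Real.measurable_log.neg gauss_int.1
  rw [gaussM, ae_withDensity_iff gDens_meas] at hlog
  rw [← Measure.restrict_congr_set (Ioo_ae_eq_Icc (μ := volume) (a := (0:ℝ)) (b := 1))]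
  filter_upwards [hlog, ae_restrict_mem measurableSet_Ioo] with r h1 hr hirr
  have h2 := h1 (by simpa using gDens_pos hr.1.le)
  have h3 : ∫ x, -Real.log x ∂gaussM = π^2 / (12 * Real.log 2) := gauss_int.2
  have h2' : Tendsto (fun n : ℕ => birkhoffSum gaussMap (fun x => -Real.log x) n r / n) atTop
      (nhds (π^2 / (12 * Real.log 2))) := by
    rw [← h3]; exact h2
  have hd : Tendsto (fun n : ℕ => Real.log (qDen r n) / (n : ℝ)
      - birkhoffSum gaussMap (fun x => -Real.log x) n r / n) atTop (nhds 0) := by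
    have hz : Tendsto (fun n : ℕ => Real.log 2 / (n:ℝ)) atTop (nhds 0) :=
      tendsto_const_nhds.div_atTop tendsto_natCast_atTop_atTop
    refine squeeze_zero_norm' ?_ hz
    filter_upwards [eventually_ge_atTop 1] with n hn
    obtain ⟨k, rfl⟩ : ∃ k, n = k + 1 := ⟨n-1, by omega⟩
    rw [← sub_div, norm_div, Real.norm_eq_abs, Real.norm_natCast]
    have := qDen_log hirr hr k
    gcongr
  have := hd.add h2'
  simpa using this
end
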